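/- arXiv:2309.00103 — 4 statements merged into one kernel-verified Lean document; each statement's English description precedes it below -/
import Mathlib

section
/- Let d, n ≥ 1 be integers and let A and B be measurable subsets of the torus T^d of positive measure. Let A' = I × T^{d−1} and B' = J × T^{d−1} be bands in T^d, where I and J are closed intervals in T, with |A'| = |A| and |B'| = |B|. Then for points b_1, …, b_n chosen independently and uniformly at random from B, and b'_1, …, b'_n chosen independently and uniformly at random from B', one has E(|⋃_{i=1}^n (A + b_i)|) ≥ E(|⋃_{i=1}^n (A' + b'_i)|). -/
open MeasureTheory

/-- The circle `ℝ/ℤ`. -/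
abbrev 𝕋 := AddCircle (1 : ℝ)

/-- The expected (Haar) measure of `⋃ i, (A i + b i)` in the torus `𝕋^d`, where each `b i`
is chosen independently and uniformly at random from `B i`. -/
noncomputable def expUnionT {d n : ℕ} (A B : Fin n → Set (Fin d → 𝕋)) : ℝ :=
  ((∏ i, volume (B i))⁻¹ *
    ∫⁻ b in Set.univ.pi B, volume (⋃ i, (· + b i) '' (A i))).toReal

open Set Filter Topology
open scoped symmDiff

section Overlap

variable {G : Type*} [AddCommGroup G] [MeasurableSpace G]

/-- The convolution `1_A * 1_B`, evaluated at `x`. -/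
noncomputable def overlap (μ : Measure G) (A B : Set G) (x : G) : ℝ :=
  μ.real (B ∩ (fun y => x - y) ⁻¹' A)

/-- The integral of the positive part of `t - 1_A * 1_B`. -/
noncomputable def deficit (μ : Measure G) (A B : Set G) (t : ℝ) : ℝ :=
  ∫ x, max (t - overlap μ A B x) 0 ∂μ

variable {μ : Measure G} {A A' B : Set G}

lemma overlap_nonneg (x : G) : 0 ≤ overlap μ A B x := measureReal_nonneg

variable [IsProbabilityMeasure μ]

lemma overlap_le_right (x : G) : overlap μ A B x ≤ μ.real B :=
  measureReal_mono inter_subset_left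

lemma overlap_mono (h : A ⊆ A') (x : G) : overlap μ A B x ≤ overlap μ A' B x :=
  measureReal_mono (inter_subset_inter_right _ (preimage_mono h))

variable [MeasurableAdd₂ G] [MeasurableNeg G]

lemma measurable_sub_of_left (x : G) : Measurable (fun y : G => x - y) := by
  simp only [sub_eq_add_neg]; fun_prop

lemma measurable_overlap (hA : MeasurableSet A) (hB : MeasurableSet B) :
    Measurable (overlap μ A B) := by
  have h : MeasurableSet {p : G × G | p.2 ∈ B ∧ p.1 - p.2 ∈ A} :=
    (measurable_snd hB).inter
      ((show Measurable fun p : G × G => p.1 - p.2 by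
        simp only [sub_eq_add_neg]; fun_prop) hA)
  exact (measurable_measure_prodMk_left (ν := μ) h).ennreal_toReal

lemma integrable_overlap (hA : MeasurableSet A) (hB : MeasurableSet B) :
    Integrable (overlap μ A B) μ :=
  Integrable.of_bound (measurable_overlap hA hB).aestronglyMeasurable 1
    (ae_of_all _ fun x => by
      rw [Real.norm_of_nonneg (overlap_nonneg x)]
      exact (overlap_le_right x).trans measureReal_le_one)

lemma integrable_deficit (hA : MeasurableSet A) (hB : MeasurableSet B) (t : ℝ) :
    Integrable (fun x => max (t - overlap μ A B x) 0) μ :=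
  ((integrable_const t).sub (integrable_overlap hA hB)).pos_part

lemma overlap_union_add_inter (hA' : MeasurableSet A')
    (hB : MeasurableSet B) (x : G) :
    overlap μ (A ∪ A') B x + overlap μ (A ∩ A') B x = overlap μ A B x + overlap μ A' B x := by
  simp only [overlap, preimage_union, preimage_inter]
  rw [inter_union_distrib_left, inter_inter_distrib_left]
  exact measureReal_union_add_inter (hB.inter (measurable_sub_of_left x hA'))

lemma deficit_add_le (hA : MeasurableSet A) (hA' : MeasurableSet A') (hB : MeasurableSet B)
    (t : ℝ) :
    deficit μ A B t + deficit μ A' B t ≤ deficit μ (A ∩ A') B t + deficit μ (A ∪ A') B t := by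
  unfold deficit
  rw [← integral_add (integrable_deficit hA hB t) (integrable_deficit hA' hB t),
    ← integral_add (integrable_deficit (hA.inter hA') hB t)
      (integrable_deficit (hA.union hA') hB t)]
  refine integral_mono ((integrable_deficit hA hB t).add (integrable_deficit hA' hB t))
    ((integrable_deficit (hA.inter hA') hB t).add
      (integrable_deficit (hA.union hA') hB t)) fun x => ?_
  have h := overlap_union_add_inter (μ := μ) (A := A) hA' hB x
  have h1 := overlap_mono (μ := μ) (B := B) (inter_subset_left : A ∩ A' ⊆ A) x
  have h2 := overlap_mono (μ := μ) (B := B) (inter_subset_right : A ∩ A' ⊆ A') x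
  simp only
  rcases max_cases (t - overlap μ A B x) 0 with h3 | h3 <;>
  rcases max_cases (t - overlap μ A' B x) 0 with h4 | h4 <;>
  rcases max_cases (t - overlap μ (A ∩ A') B x) 0 with h5 | h5 <;>
  rcases max_cases (t - overlap μ (A ∪ A') B x) 0 with h6 | h6 <;>
  linarith

variable [μ.IsAddLeftInvariant]

omit [IsProbabilityMeasure μ] [MeasurableNeg G] in
lemma measureReal_preimage_sub_right (A : Set G) (g : G) :
    μ.real ((fun x => x - g) ⁻¹' A) = μ.real A := by
  simp only [measureReal_def, sub_eq_add_neg, add_comm _ (-g), measure_preimage_add]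

lemma integral_overlap (hA : MeasurableSet A) (hB : MeasurableSet B) :
    ∫ x, overlap μ A B x ∂μ = μ.real A * μ.real B := by
  have h : MeasurableSet {p : G × G | p.2 ∈ B ∧ p.1 - p.2 ∈ A} :=
    (measurable_snd hB).inter
      ((show Measurable fun p : G × G => p.1 - p.2 by
        simp only [sub_eq_add_neg]; fun_prop) hA)
  have e : ∫⁻ x, μ (B ∩ (fun y => x - y) ⁻¹' A) ∂μ = μ A * μ B := by
    calc ∫⁻ x, μ (B ∩ (fun y => x - y) ⁻¹' A) ∂μ
        = (μ.prod μ) {p : G × G | p.2 ∈ B ∧ p.1 - p.2 ∈ A} := (Measure.prod_apply h).symm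
      _ = ∫⁻ y, B.indicator (fun _ => μ A) y ∂μ := by
          rw [Measure.prod_apply_symm h]
          refine lintegral_congr fun y => ?_
          by_cases hy : y ∈ B
          · simp only [hy, indicator_of_mem]
            rw [← measure_preimage_add μ (-y) A]
            congr 1
            ext x
            simp [hy, sub_eq_add_neg, add_comm]
          · simp [hy]
      _ = μ A * μ B := by rw [lintegral_indicator hB, setLIntegral_const]
  unfold overlap
  simp only [measureReal_def]
  rw [integral_toReal, e, ENNReal.toReal_mul]
  · exact (measurable_measure_prodMk_left (ν := μ) h).aemeasurable
  · exact ae_of_all _ fun x => measure_lt_top _ _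

omit [IsProbabilityMeasure μ] [MeasurableNeg G] in
lemma deficit_preimage_sub_right (A B : Set G) (t : ℝ) (g : G) :
    deficit μ ((fun x => x - g) ⁻¹' A) B t = deficit μ A B t := by
  have h : ∀ x, overlap μ ((fun x => x - g) ⁻¹' A) B x = overlap μ A B (-g + x) := by
    intro x
    unfold overlap
    congr 2
    ext y
    simp only [mem_preimage]
    rw [show x - y - g = -g + x - y by abel]
  unfold deficit
  simp only [h]
  exact integral_add_left_eq_self (fun x => max (t - overlap μ A B x) 0) (-g)

lemma le_deficit (hA : MeasurableSet A) (hB : MeasurableSet B) (t : ℝ) :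
    t - μ.real A * μ.real B ≤ deficit μ A B t := by
  calc t - μ.real A * μ.real B = ∫ x, (t - overlap μ A B x) ∂μ := by
        rw [integral_sub (integrable_const t) (integrable_overlap hA hB),
          integral_overlap hA hB]
        simp
    _ ≤ _ := integral_mono ((integrable_const t).sub (integrable_overlap hA hB))
        (integrable_deficit hA hB t) fun x => le_max_left _ _

omit [IsProbabilityMeasure μ] [MeasurableAdd₂ G] [MeasurableNeg G] [μ.IsAddLeftInvariant] in
lemma deficit_nonneg (A B : Set G) (t : ℝ) : 0 ≤ deficit μ A B t :=
  integral_nonneg fun _ => le_max_right _ _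

omit [MeasurableAdd₂ G] [MeasurableNeg G] [μ.IsAddLeftInvariant] in
lemma deficit_le (A B : Set G) {t : ℝ} (ht : 0 ≤ t) : deficit μ A B t ≤ t := by
  calc deficit μ A B t ≤ ∫ _, t ∂μ :=
        integral_mono_of_nonneg (ae_of_all _ fun _ => le_max_right _ _) (integrable_const t)
          (ae_of_all _ fun x => max_le (by linarith [overlap_nonneg (μ := μ) (A := A) (B := B) x])
            ht)
    _ = t := by simp

variable [μ.IsNegInvariant]

omit [IsProbabilityMeasure μ] in
lemma measureReal_preimage_sub_left (hA : MeasurableSet A) (x : G) :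
    μ.real ((fun y => x - y) ⁻¹' A) = μ.real A := by
  simp only [measureReal_def]
  rw [(Measure.measurePreserving_sub_left μ x).measure_preimage hA.nullMeasurableSet]

lemma overlap_le_left (hA : MeasurableSet A) (x : G) : overlap μ A B x ≤ μ.real A :=
  (measureReal_mono inter_subset_right).trans_eq (measureReal_preimage_sub_left hA x)

lemma le_overlap (hA : MeasurableSet A) (x : G) :
    μ.real A + μ.real B - 1 ≤ overlap μ A B x := by
  have h := measureReal_union_add_inter (μ := μ) (s := B) (measurable_sub_of_left x hA)
  rw [measureReal_preimage_sub_left hA] at h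
  have := measureReal_le_one (μ := μ) (s := B ∪ (fun y => x - y) ⁻¹' A)
  unfold overlap
  linarith

lemma deficit_le_of_measureReal_le (hA : MeasurableSet A) (hB : MeasurableSet B) {t a : ℝ}
    (hta : t ≤ a) (ha : μ.real A ≤ a) : deficit μ A B t ≤ a - μ.real A * μ.real B := by
  calc deficit μ A B t ≤ ∫ x, (a - overlap μ A B x) ∂μ :=
        integral_mono (integrable_deficit hA hB t)
          ((integrable_const a).sub (integrable_overlap hA hB)) fun x =>
          max_le (by simp only; linarith)
            (by have := overlap_le_left (B := B) (μ := μ) hA x; simp only; linarith)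
    _ = _ := by
        rw [integral_sub (integrable_const a) (integrable_overlap hA hB),
          integral_overlap hA hB]
        simp

lemma deficit_le_of_le_measureReal (hA : MeasurableSet A) {t s : ℝ} (hs : 0 ≤ s)
    (h : 1 - μ.real B + t - s ≤ μ.real A) : deficit μ A B t ≤ s := by
  calc deficit μ A B t ≤ ∫ _, s ∂μ :=
        integral_mono_of_nonneg (ae_of_all _ fun _ => le_max_right _ _) (integrable_const s)
          (ae_of_all _ fun x =>
            max_le (by linarith [le_overlap (μ := μ) (B := B) hA x]) hs)
    _ = s := by simp

variable [TopologicalSpace G] [IsTopologicalAddGroup G] [BorelSpace G]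
  [μ.InnerRegularCompactLTTop]

omit [MeasurableAdd₂ G] [MeasurableNeg G] [μ.IsNegInvariant] in
lemma continuous_measureReal_inter_preimage_sub (hA : MeasurableSet A) :
    Continuous fun g : G => μ.real (A ∩ (fun x => x - g) ⁻¹' A) := by
  let f : C(G, C(G, G)) := ContinuousMap.curry ⟨fun p : G × G => p.2 - p.1, by fun_prop⟩
  rw [continuous_iff_continuousAt]
  intro g
  have hmp : ∀ g, MeasurePreserving (f g) μ μ := fun g => by
    have := measurePreserving_add_left μ (-g)
    convert this using 1
    ext x
    simp [f, ContinuousMap.curry_apply, sub_eq_add_neg, add_comm]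
  have h := tendsto_measure_symmDiff_preimage_nhds_zero (f.continuous.tendsto g)
    (Eventually.of_forall hmp) (hmp g) hA.nullMeasurableSet (measure_ne_top μ A)
  have h' : Tendsto (fun a => μ.real ((f a ⁻¹' A) ∆ (f g ⁻¹' A))) (𝓝 g) (𝓝 0) := by
    simpa [measureReal_def, Function.comp_def] using
      (ENNReal.tendsto_toReal ENNReal.zero_ne_top).comp h
  rw [ContinuousAt, tendsto_iff_dist_tendsto_zero]
  refine squeeze_zero (fun _ => dist_nonneg) (fun a => ?_) h'
  have hm : ∀ g, MeasurableSet (A ∩ f g ⁻¹' A) := fun g => hA.inter ((hmp g).measurable hA)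
  refine (abs_measureReal_sub_le_measureReal_symmDiff (hm a).nullMeasurableSet
    (hm g).nullMeasurableSet).trans (measureReal_mono ?_)
  rw [← inter_symmDiff_distrib_left]
  exact inter_subset_right

lemma exists_measureReal_inter_preimage_sub_eq [ConnectedSpace G] (hA : MeasurableSet A) {c : ℝ}
    (h1 : μ.real A ^ 2 ≤ c) (h2 : c ≤ μ.real A) :
    ∃ g : G, μ.real (A ∩ (fun x => x - g) ⁻¹' A) = c := by
  have hcont := continuous_measureReal_inter_preimage_sub (μ := μ) hA
  have hI : ∫ g, μ.real (A ∩ (fun x => x - g) ⁻¹' A) ∂μ = μ.real A ^ 2 := by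
    have := integral_overlap (μ := μ) (measurable_neg hA) hA
    rw [show Neg.neg ⁻¹' A = (fun y => 0 - y) ⁻¹' A by ext; simp,
      measureReal_preimage_sub_left hA] at this
    rw [sq, ← this]
    refine integral_congr_ae (ae_of_all _ fun g => ?_)
    simp only [overlap]
    congr 2
    ext y
    simp
  obtain ⟨g, hg⟩ : ∃ g : G, μ.real (A ∩ (fun x => x - g) ⁻¹' A) ≤ c := by
    by_contra! hcon
    have hint : Integrable (fun g : G => μ.real (A ∩ (fun x => x - g) ⁻¹' A)) μ :=
      Integrable.of_bound hcont.measurable.aestronglyMeasurable 1 (ae_of_all _ fun x => by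
        rw [Real.norm_of_nonneg measureReal_nonneg]; exact measureReal_le_one)
    obtain ⟨g, hg⟩ := exists_le_integral hint
    linarith [hcon g]
  obtain ⟨k, hk⟩ := intermediate_value_univ g 0 hcont ⟨hg, by simpa using h2⟩
  exact ⟨k, hk⟩

/-- The **Kneser–Pollard inequality** on connected compact abelian groups. -/
lemma deficit_le_mul [ConnectedSpace G] (hA : MeasurableSet A) (hB : MeasurableSet B) {t : ℝ}
    (ht : 0 ≤ t) (htB : t ≤ μ.real B) (htA : t ≤ μ.real A)
    (hAt : μ.real A ≤ 1 - μ.real B + t) :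
    deficit μ A B t ≤ t * (1 - μ.real A - μ.real B + t) := by
  set b := μ.real B with hb
  have hb1 : b ≤ 1 := measureReal_le_one
  refine le_of_forall_pos_le_add fun ε hε => ?_
  let Φ : Set G → ℝ := fun C => deficit μ C B t - t * (1 - μ.real C - b + t) + ε * μ.real C ^ 2
  let S : Set ℝ := Φ '' {C | MeasurableSet C ∧ t ≤ μ.real C ∧ μ.real C ≤ 1 - b + t}
  have hΦA : Φ A ∈ S := ⟨A, ⟨hA, htA, hAt⟩, rfl⟩
  have hSb : BddAbove S := by
    refine ⟨t + ε, ?_⟩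
    rintro _ ⟨C, ⟨_, h1, h2⟩, rfl⟩
    have h3 := deficit_le (μ := μ) C B ht
    have h4 : 0 ≤ t * (1 - μ.real C - b + t) := mul_nonneg ht (by linarith)
    have h5 : μ.real C ≤ 1 := measureReal_le_one
    have h6 : ε * μ.real C ^ 2 ≤ ε * 1 := by
      gcongr
      exact pow_le_one₀ measureReal_nonneg h5
    simp only [Φ]
    linarith
  suffices hS : sSup S ≤ ε by
    have h1 := (le_csSup hSb hΦA).trans hS
    have h2 : 0 ≤ ε * μ.real A ^ 2 := by positivity
    simp only [Φ] at h1
    linarith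
  by_contra! hcon
  obtain ⟨κ, hκ, hκS⟩ : ∃ κ, 0 < κ ∧ ε + κ < sSup S :=
    ⟨(sSup S - ε) / 2, by linarith, by linarith⟩
  obtain ⟨_, ⟨C, ⟨hC, hC1, hC2⟩, rfl⟩, hCS⟩ :=
    exists_lt_of_lt_csSup ⟨_, hΦA⟩
      (max_lt hκS (show sSup S - ε * κ ^ 4 < sSup S by nlinarith [mul_pos hε (pow_pos hκ 4)]))
  have hCκ := (le_max_left _ _).trans_lt hCS
  have hCε := (le_max_right _ _).trans_lt hCS
  set c := μ.real C with hc
  have hc1 : c ≤ 1 := measureReal_le_one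
  have hεc : ε * c ^ 2 ≤ ε := by
    have : c ^ 2 ≤ 1 := pow_le_one₀ measureReal_nonneg hc1
    nlinarith
  have hlow : t + κ ≤ c := by
    have := deficit_le_of_measureReal_le (t := t) hC hB hC1 le_rfl
    simp only [Φ] at hCκ
    nlinarith [mul_nonneg (sub_nonneg.2 hC1) (show 0 ≤ b - t by linarith)]
  have hupp : c ≤ 1 - b + t - κ := by
    have := deficit_le_of_le_measureReal (t := t) (s := 1 - b + t - c) (B := B) hC
      (by linarith) (by linarith)
    simp only [Φ] at hCκ
    nlinarith [mul_nonneg ht (show 0 ≤ 1 - b + t - c by linarith)]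
  have hκ1 : κ ≤ 1 := by linarith
  have hκ2 : κ ^ 2 ≤ κ := by nlinarith
  obtain ⟨g, hg⟩ := exists_measureReal_inter_preimage_sub_eq (μ := μ) hC (c := c - κ ^ 2)
    (by
      rw [← hc]
      nlinarith [mul_le_mul (show κ ≤ c by linarith) (show κ ≤ 1 - c by linarith) hκ.le
        (hκ.le.trans (by linarith))])
    (by nlinarith [sq_nonneg κ])
  set C' := (fun x => x - g) ⁻¹' C
  have hC' : MeasurableSet C' := by
    have : Measurable fun x : G => x - g := by simp only [sub_eq_add_neg]; fun_prop
    exact this hC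
  have hcC' : μ.real C' = c := measureReal_preimage_sub_right C g
  have hun : μ.real (C ∪ C') = c + κ ^ 2 := by
    have := measureReal_union_add_inter (μ := μ) (s := C) hC'
    linarith
  have h1 := le_csSup hSb (mem_image_of_mem Φ (show C ∩ C' ∈ {C | MeasurableSet C ∧
    t ≤ μ.real C ∧ μ.real C ≤ 1 - b + t} from ⟨hC.inter hC', by linarith, by
      nlinarith [sq_nonneg κ]⟩))
  have h2 := le_csSup hSb (mem_image_of_mem Φ (show C ∪ C' ∈ {C | MeasurableSet C ∧
    t ≤ μ.real C ∧ μ.real C ≤ 1 - b + t} from ⟨hC.union hC', by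
      nlinarith [sq_nonneg κ], by linarith⟩))
  have h3 := deficit_add_le (μ := μ) hC hC' hB t
  rw [deficit_preimage_sub_right] at h3
  simp only [Φ, hg, hun, ← hc] at h1 h2 hCε
  nlinarith

end Overlap

section Circle

instance : IsProbabilityMeasure (volume : Measure 𝕋) := ⟨UnitAddCircle.measure_univ⟩

instance : (volume : Measure 𝕋).IsNegInvariant := inferInstance

lemma volume_image_coe_Icc_le {u v : ℝ} :
    volume ((fun r : ℝ => (r : 𝕋)) '' Icc u v) ≤ ENNReal.ofReal (v - u) := by
  calc volume ((fun r : ℝ => (r : 𝕋)) '' Icc u v)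
      ≤ volume (Metric.closedBall (((u + v) / 2 : ℝ) : 𝕋) ((v - u) / 2)) := by
        refine measure_mono ?_
        rintro _ ⟨r, hr, rfl⟩
        rw [Metric.mem_closedBall, dist_eq_norm, ← AddCircle.coe_sub]
        refine (QuotientAddGroup.norm_mk_le_norm).trans ?_
        rw [Real.norm_eq_abs, abs_le]
        constructor <;> linarith [hr.1, hr.2]
    _ ≤ _ := by
        rw [AddCircle.volume_closedBall]
        exact ENNReal.ofReal_le_ofReal ((min_le_right _ _).trans_eq (by ring))

lemma measurableSet_image_coe_Icc (u v : ℝ) :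
    MeasurableSet ((fun r : ℝ => (r : 𝕋)) '' Icc u v) :=
  (isCompact_Icc.image (AddCircle.continuous_mk' 1)).isClosed.measurableSet

lemma le_measureReal_image_coe_Icc {u v : ℝ} (h : v - u ≤ 1) :
    v - u ≤ volume.real ((fun r : ℝ => (r : 𝕋)) '' Icc u v) := by
  rw [measureReal_def, ← ENNReal.ofReal_le_iff_le_toReal (measure_ne_top _ _),
    AddCircle.add_projection_respects_measure 1 u (measurableSet_image_coe_Icc u v),
    ← Real.volume_Ioc]
  exact measure_mono fun x hx => ⟨⟨x, Ioc_subset_Icc_self hx, rfl⟩, hx.1, by linarith [hx.2]⟩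

lemma le_overlap_of_image_coe_Icc_subset {I J : Set 𝕋} {p q a b : ℝ} (hb1 : b ≤ 1)
    (hI : (fun r : ℝ => (r : 𝕋)) '' Icc p (p + a) ⊆ I)
    (hJ : (fun r : ℝ => (r : 𝕋)) '' Icc q (q + b) ⊆ J) (ξ : ℝ) :
    b - max 0 (b - ξ) - max 0 (ξ - a) ≤ overlap volume I J ((p + q + ξ : ℝ) : 𝕋) := by
  have h := le_measureReal_image_coe_Icc (u := q + max 0 (ξ - a)) (v := q + b - max 0 (b - ξ))
    (by linarith [le_max_left 0 (ξ - a), le_max_left 0 (b - ξ)])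
  have hsub : (fun r : ℝ => (r : 𝕋)) '' Icc (q + max 0 (ξ - a)) (q + b - max 0 (b - ξ)) ⊆
      J ∩ (fun y => ((p + q + ξ : ℝ) : 𝕋) - y) ⁻¹' I := by
    rintro _ ⟨r, ⟨h1, h2⟩, rfl⟩
    have h3 := le_max_left 0 (ξ - a)
    have h4 := le_max_right 0 (ξ - a)
    have h5 := le_max_left 0 (b - ξ)
    have h6 := le_max_right 0 (b - ξ)
    refine ⟨hJ ⟨r, ⟨by linarith, by linarith⟩, rfl⟩, ?_⟩
    rw [mem_preimage, ← AddCircle.coe_sub]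
    exact hI ⟨_, ⟨by linarith, by linarith⟩, rfl⟩
  have := measureReal_mono (μ := volume) hsub
  unfold overlap
  linarith

lemma integral_max_zero {u v : ℝ} (hu : u ≤ 0) (hv : 0 ≤ v) :
    ∫ x in u..v, max 0 x = v ^ 2 / 2 := by
  have hc : Continuous fun x : ℝ => max 0 x := by fun_prop
  rw [← intervalIntegral.integral_add_adjacent_intervals
    (hc.intervalIntegrable u 0) (hc.intervalIntegrable 0 v),
    intervalIntegral.integral_congr (g := fun _ => (0 : ℝ)) (a := u) (b := 0),
    intervalIntegral.integral_congr (g := fun x => x) (a := 0) (b := v)]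
  · simp
  · intro x hx
    rw [uIcc_of_le hv] at hx
    exact max_eq_right hx.1
  · intro x hx
    rw [uIcc_of_le hu] at hx
    exact max_eq_left hx.2

lemma mul_le_deficit_of_image_coe_Icc_subset {I J : Set 𝕋} (hI : MeasurableSet I)
    (hJ : MeasurableSet J) {p q t : ℝ} (ht : 0 ≤ t)
    (htI : t ≤ volume.real I) (htJ : t ≤ volume.real J)
    (h1 : volume.real I + volume.real J - t ≤ 1)
    (hpI : (fun r : ℝ => (r : 𝕋)) '' Icc p (p + volume.real I) ⊆ I)
    (hqJ : (fun r : ℝ => (r : 𝕋)) '' Icc q (q + volume.real J) ⊆ J) :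
    t * (1 - volume.real I - volume.real J + t) ≤ deficit volume I J t := by
  have hlow := le_overlap_of_image_coe_Icc_subset measureReal_le_one hpI hqJ
  have hio := integrable_overlap (μ := volume) hI hJ
  have hint : Integrable (fun x => max (overlap volume I J x - t) 0) :=
    (hio.sub (integrable_const t)).pos_part
  have hdef : deficit volume I J t = t - volume.real I * volume.real J +
      ∫ x, max (overlap volume I J x - t) 0 := by
    calc deficit volume I J t
        = ∫ x, ((t - overlap volume I J x) + max (overlap volume I J x - t) 0) := by
          unfold deficit
          congr 1 with x
          rcases le_total t (overlap volume I J x) with h | h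
          · rw [max_eq_right (by linarith), max_eq_left (by linarith)]; ring
          · rw [max_eq_left (by linarith), max_eq_right (by linarith)]; ring
      _ = _ := by
          rw [integral_add (f := fun x => t - overlap volume I J x)
            ((integrable_const t).sub hio) hint,
            integral_sub (integrable_const t) hio, integral_overlap hI hJ]
          simp
  set a := volume.real I
  set b := volume.real J
  let F : 𝕋 → ℝ := fun x => max (overlap volume I J (((p + q : ℝ) : 𝕋) + x) - t) 0
  have hF : ∀ ξ : ℝ, b - t - max 0 (b - ξ) - max 0 (ξ - a) ≤ F ξ := fun ξ => by
    refine le_max_of_le_left ?_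
    rw [← AddCircle.coe_add]
    linarith [hlow ξ]
  have hFint : Integrable F := hint.comp_add_left _
  have hFI : ∫ ξ in (0 : ℝ)..0 + 1, F ξ = ∫ x, max (overlap volume I J x - t) 0 := by
    rw [UnitAddCircle.intervalIntegral_preimage 0 F]
    exact integral_add_left_eq_self (fun x => max (overlap volume I J x - t) 0) _
  have hFi : IntervalIntegrable (fun ξ : ℝ => F ξ) volume 0 (0 + 1) := by
    rw [intervalIntegrable_iff_integrableOn_Ioc_of_le (by norm_num)]
    exact (UnitAddCircle.measurePreserving_mk 0).integrable_comp_of_integrable hFint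
  have hst : t ≤ a + b - t := by linarith
  have hsub : uIcc t (a + b - t) ⊆ uIcc 0 (0 + 1) := by
    rw [uIcc_of_le hst, uIcc_of_le (by norm_num)]
    exact Icc_subset_Icc ht (by linarith)
  have hk : Continuous fun ξ : ℝ => b - t - max 0 (b - ξ) - max 0 (ξ - a) := by fun_prop
  have e1 : ∫ ξ in t..(a + b - t), max 0 (b - ξ) = (b - t) ^ 2 / 2 := by
    rw [intervalIntegral.integral_comp_sub_left (fun x => max 0 x) b,
      integral_max_zero (by linarith) (by linarith)]
  have e2 : ∫ ξ in t..(a + b - t), max 0 (ξ - a) = (b - t) ^ 2 / 2 := by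
    rw [intervalIntegral.integral_comp_sub_right (fun x => max 0 x) a,
      integral_max_zero (by linarith) (by linarith)]
    ring
  have hc1 : Continuous fun ξ : ℝ => max 0 (b - ξ) := by fun_prop
  have hc2 : Continuous fun ξ : ℝ => max 0 (ξ - a) := by fun_prop
  have e3 : ∫ ξ in t..(a + b - t), (b - t - max 0 (b - ξ) - max 0 (ξ - a)) =
      (a - t) * (b - t) := by
    rw [intervalIntegral.integral_sub _ (hc2.intervalIntegrable _ _),
      intervalIntegral.integral_sub _ (hc1.intervalIntegrable _ _), e1, e2]
    · simp only [intervalIntegral.integral_const, smul_eq_mul]; ring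
    · exact intervalIntegrable_const
    · exact (continuous_const.sub hc1).intervalIntegrable _ _
  have h2 : (a - t) * (b - t) ≤ ∫ ξ in t..(a + b - t), F ξ := by
    rw [← e3]
    exact intervalIntegral.integral_mono_on hst (hk.intervalIntegrable _ _) (hFi.mono_set hsub)
      fun ξ _ => hF ξ
  have h3 : ∫ ξ in t..(a + b - t), F ξ ≤ ∫ ξ in (0 : ℝ)..0 + 1, F ξ :=
    intervalIntegral.integral_mono_interval ht hst (by linarith)
      (ae_of_all _ fun ξ => le_max_right _ _) hFi
  rw [hdef, ← hFI]
  nlinarith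

end Circle

section Torus

variable {d : ℕ}

lemma measurePreserving_eval_zero :
    MeasurePreserving (fun x : Fin (d + 1) → 𝕋 => x 0) volume volume :=
  measurePreserving_eval (fun _ : Fin (d + 1) => (volume : Measure 𝕋)) 0

lemma overlap_preimage_eval_zero {I J : Set 𝕋} (hI : MeasurableSet I) (hJ : MeasurableSet J)
    (x : Fin (d + 1) → 𝕋) :
    overlap volume {x : Fin (d + 1) → 𝕋 | x 0 ∈ I} {x | x 0 ∈ J} x = overlap volume I J (x 0) := by
  have h : MeasurableSet (J ∩ (fun y => x 0 - y) ⁻¹' I) :=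
    hJ.inter (measurable_const.sub measurable_id hI)
  unfold overlap
  simp only [measureReal_def]
  rw [← measurePreserving_eval_zero.measure_preimage h.nullMeasurableSet]
  rfl

lemma deficit_preimage_eval_zero {I J : Set 𝕋} (hI : MeasurableSet I) (hJ : MeasurableSet J)
    (t : ℝ) :
    deficit volume {x : Fin (d + 1) → 𝕋 | x 0 ∈ I} {x | x 0 ∈ J} t = deficit volume I J t := by
  unfold deficit
  simp only [overlap_preimage_eval_zero hI hJ]
  rw [← measurePreserving_eval_zero.map_eq, integral_map, measurePreserving_eval_zero.map_eq]
  · exact measurePreserving_eval_zero.measurable.aemeasurable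
  · rw [measurePreserving_eval_zero.map_eq]
    exact (integrable_deficit hI hJ t).aestronglyMeasurable

end Torus

section Majorization

lemma integral_pow_mul_max_sub {s b : ℝ} (hs : 0 ≤ s) (hsb : s ≤ b) (k : ℕ) :
    ∫ t in (0 : ℝ)..b, (b - t) ^ k * max (t - s) 0 =
      (b - s) ^ (k + 2) / ((k + 1) * (k + 2)) := by
  have hc : Continuous fun t : ℝ => (b - t) ^ k * max (t - s) 0 := by fun_prop
  have h1 : ∫ t in (0 : ℝ)..s, (b - t) ^ k * max (t - s) 0 = 0 := by
    rw [intervalIntegral.integral_congr (g := fun _ => (0 : ℝ))]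
    · simp
    · intro t ht
      rw [uIcc_of_le hs] at ht
      simp [max_eq_right (sub_nonpos.2 ht.2)]
  have h2 : ∫ t in s..b, (b - t) ^ k * max (t - s) 0 =
      (b - s) ^ (k + 2) / ((k + 1) * (k + 2)) := by
    rw [intervalIntegral.integral_congr
      (g := fun t => (fun u => (b - s) * u ^ k - u ^ (k + 1)) (b - t))]
    · rw [intervalIntegral.integral_comp_sub_left (fun u => (b - s) * u ^ k - u ^ (k + 1)) b,
        intervalIntegral.integral_sub (Continuous.intervalIntegrable (by fun_prop) _ _)
          (Continuous.intervalIntegrable (by fun_prop) _ _),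
        intervalIntegral.integral_const_mul, integral_pow, integral_pow]
      have : (k : ℝ) + 1 + 1 ≠ 0 := by positivity
      have : (k : ℝ) + 1 ≠ 0 := by positivity
      have : (k : ℝ) + 2 ≠ 0 := by positivity
      push_cast
      simp only [sub_self, ne_eq, Nat.add_eq_zero_iff, one_ne_zero, and_false, not_false_eq_true,
        zero_pow, sub_zero]
      field_simp
      ring
    · intro t ht
      rw [uIcc_of_le hsb] at ht
      simp only [max_eq_left (sub_nonneg.2 ht.1)]
      ring
  rw [← intervalIntegral.integral_add_adjacent_intervals (hc.intervalIntegrable 0 s)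
    (hc.intervalIntegrable s b), h1, h2, zero_add]

variable {X : Type*} [MeasurableSpace X] {μ : Measure X} [IsProbabilityMeasure μ]

lemma integral_sub_pow_add_two {f : X → ℝ} {b : ℝ} (hb : 0 ≤ b) (hf : Measurable f)
    (h0 : ∀ x, 0 ≤ f x) (h1 : ∀ x, f x ≤ b) (k : ℕ) :
    ∫ x, (b - f x) ^ (k + 2) ∂μ =
      ((k + 1) * (k + 2)) * ∫ t in Ioc 0 b, (b - t) ^ k * ∫ x, max (t - f x) 0 ∂μ := by
  have hint : Integrable (Function.uncurry fun x t => (b - t) ^ k * max (t - f x) 0)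
      (μ.prod (volume.restrict (Ioc 0 b))) := by
    refine Integrable.of_bound (C := b ^ k * b) ?_ ?_
    · exact Measurable.aestronglyMeasurable (by unfold Function.uncurry; fun_prop)
    · have : ∀ᵐ p ∂(μ.prod (volume.restrict (Ioc 0 b))), p.2 ∈ Ioc 0 b :=
        Measure.quasiMeasurePreserving_snd.ae (ae_restrict_mem measurableSet_Ioc)
      filter_upwards [this] with p hp
      have h2 : 0 ≤ b - p.2 := sub_nonneg.2 hp.2
      have h3 := le_max_right (p.2 - f p.1) 0
      simp only [Function.uncurry]
      rw [Real.norm_of_nonneg (by positivity)]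
      gcongr
      · linarith [hp.1]
      · exact max_le (by linarith [h0 p.1, hp.2]) hb
  simp only [← integral_const_mul]
  rw [← integral_integral_swap (by
    exact hint.const_mul (((k : ℝ) + 1) * (k + 2)))]
  refine integral_congr_ae (ae_of_all _ fun x => ?_)
  simp only
  rw [integral_const_mul, ← intervalIntegral.integral_of_le hb,
    integral_pow_mul_max_sub (h0 x) (h1 x), mul_div_cancel₀]
  positivity

lemma integral_sub_pow_le {f g : X → ℝ} {b : ℝ} (hf : Measurable f) (hg : Measurable g)
    (hb : 0 ≤ b) (hf0 : ∀ x, 0 ≤ f x) (hf1 : ∀ x, f x ≤ b) (hg0 : ∀ x, 0 ≤ g x)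
    (hg1 : ∀ x, g x ≤ b)
    (h : ∀ t, 0 ≤ t → t ≤ b → ∫ x, max (t - f x) 0 ∂μ ≤ ∫ x, max (t - g x) 0 ∂μ) (n : ℕ) :
    ∫ x, (b - f x) ^ n ∂μ ≤ ∫ x, (b - g x) ^ n ∂μ := by
  match n with
  | 0 => simp
  | 1 =>
    have := h b hb le_rfl
    simpa only [pow_one, max_eq_left (sub_nonneg.2 (hf1 _)), max_eq_left (sub_nonneg.2 (hg1 _))]
      using this
  | k + 2 =>
    have hint : ∀ {u : X → ℝ}, Measurable u → (∀ x, 0 ≤ u x) →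
        IntegrableOn (fun t => (b - t) ^ k * ∫ x, max (t - u x) 0 ∂μ) (Ioc 0 b) := by
      intro u hu hu0
      have hm : StronglyMeasurable fun t : ℝ => ∫ x, max (t - u x) 0 ∂μ :=
        StronglyMeasurable.integral_prod_right'
          (f := fun p : ℝ × X => max (p.1 - u p.2) 0)
          (Measurable.stronglyMeasurable (by fun_prop))
      refine Integrable.of_bound (C := b ^ k * b) ?_ ?_
      · exact (Measurable.aestronglyMeasurable (by fun_prop)).mul hm.aestronglyMeasurable
      · filter_upwards [ae_restrict_mem measurableSet_Ioc] with t ht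
        have h2 : 0 ≤ b - t := sub_nonneg.2 ht.2
        have h3 : 0 ≤ ∫ x, max (t - u x) 0 ∂μ := integral_nonneg fun _ => le_max_right _ _
        have h4 : ∫ x, max (t - u x) 0 ∂μ ≤ b := by
          calc ∫ x, max (t - u x) 0 ∂μ ≤ ∫ _, b ∂μ :=
                integral_mono_of_nonneg (ae_of_all _ fun _ => le_max_right _ _)
                  (integrable_const b)
                  (ae_of_all _ fun x => max_le (by linarith [hu0 x, ht.2]) hb)
            _ = b := by simp
        rw [Real.norm_of_nonneg (by positivity)]
        gcongr
        linarith [ht.1]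
    rw [integral_sub_pow_add_two hb hf hf0 hf1, integral_sub_pow_add_two hb hg hg0 hg1]
    refine mul_le_mul_of_nonneg_left ?_ (by positivity)
    refine setIntegral_mono_on (hint hf hf0) (hint hg hg0) measurableSet_Ioc fun t ht => ?_
    exact mul_le_mul_of_nonneg_left (h t ht.1.le ht.2) (pow_nonneg (sub_nonneg.2 ht.2) k)

end Majorization

section ExpUnion

variable {d n : ℕ}

lemma measure_diff_preimage_eq_ofReal {A B : Set (Fin d → 𝕋)} (hA : MeasurableSet A)
    (x : Fin d → 𝕋) :
    volume (B \ (fun y => x - y) ⁻¹' A) =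
      ENNReal.ofReal (volume.real B - overlap volume A B x) := by
  have h := measureReal_inter_add_sdiff (μ := volume) (s := B)
    (show MeasurableSet ((fun y => x - y) ⁻¹' A) from measurable_const.sub measurable_id hA)
  rw [← ofReal_measureReal]
  congr 1
  unfold overlap
  linarith

lemma lintegral_volume_iUnion_add {A B : Set (Fin d → 𝕋)} (hA : MeasurableSet A)
    (hB : MeasurableSet B) (n : ℕ) :
    (∫⁻ b in Set.univ.pi (fun _ : Fin n => B), volume (⋃ i, (· + b i) '' A)) +
      ENNReal.ofReal (∫ x, (volume.real B - overlap volume A B x) ^ n) = volume B ^ n := by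
  let P : Set (Fin n → Fin d → 𝕋) := Set.univ.pi fun _ => B
  have hP : volume P = volume B ^ n := by simp [P, volume_pi, Measure.pi_pi]
  let T : Set ((Fin n → Fin d → 𝕋) × (Fin d → 𝕋)) := {p | ∀ i, p.2 - p.1 i ∉ A}
  have hT : MeasurableSet T := by
    have : T = ⋂ i, (fun p : (Fin n → Fin d → 𝕋) × (Fin d → 𝕋) => p.2 - p.1 i) ⁻¹' Aᶜ := by
      ext; simp [T]
    rw [this]
    refine MeasurableSet.iInter fun i => ?_
    have hm : Measurable fun p : (Fin n → Fin d → 𝕋) × (Fin d → 𝕋) => p.2 - p.1 i :=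
      measurable_snd.sub ((measurable_pi_apply i).comp measurable_fst)
    exact hm hA.compl
  have hU : ∀ b : Fin n → Fin d → 𝕋, (⋃ i, (· + b i) '' A) = (Prod.mk b ⁻¹' T)ᶜ := by
    intro b
    ext x
    simp [T, sub_eq_add_neg]
  have hY : ∫⁻ b in P, volume (Prod.mk b ⁻¹' T) =
      ENNReal.ofReal (∫ x, (volume.real B - overlap volume A B x) ^ n) := by
    rw [← Measure.prod_apply hT, Measure.prod_apply_symm hT,
      ofReal_integral_eq_lintegral_ofReal]
    · refine lintegral_congr fun x => ?_
      rw [Measure.restrict_apply (measurable_prodMk_right hT),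
        ENNReal.ofReal_pow (sub_nonneg.2 (overlap_le_right x)),
        ← measure_diff_preimage_eq_ofReal hA]
      have : (fun b => (b, x)) ⁻¹' T ∩ P =
          Set.univ.pi fun _ : Fin n => B \ (fun y => x - y) ⁻¹' A := by
        ext b
        simp only [T, P, mem_inter_iff, mem_preimage, mem_ofPred_eq, mem_univ_pi, Set.mem_sdiff]
        exact ⟨fun h i => ⟨h.2 i, h.1 i⟩, fun h => ⟨fun i => (h i).2, fun i => (h i).1⟩⟩
      rw [this, volume_pi, Measure.pi_pi]
      simp
    · refine Integrable.of_bound (C := 1)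
        ((measurable_const.sub (measurable_overlap hA hB)).pow_const n).aestronglyMeasurable
        (ae_of_all _ fun x => ?_)
      have h0 : 0 ≤ volume.real B - overlap volume A B x := sub_nonneg.2 (overlap_le_right x)
      rw [Real.norm_of_nonneg (pow_nonneg h0 n)]
      refine pow_le_one₀ h0 ?_
      linarith [overlap_nonneg (μ := volume) (A := A) (B := B) x,
        measureReal_le_one (μ := (volume : Measure (Fin d → 𝕋))) (s := B)]
    · exact ae_of_all _ fun x => pow_nonneg (sub_nonneg.2 (overlap_le_right x)) n
  rw [← hY, ← lintegral_add_right _ (measurable_measure_prodMk_left hT), ← hP]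
  have : ∀ b : Fin n → Fin d → 𝕋,
      volume (⋃ i, (· + b i) '' A) + volume (Prod.mk b ⁻¹' T) = 1 := by
    intro b
    rw [hU, add_comm, measure_add_measure_compl (measurable_prodMk_left hT), measure_univ]
  simp only [this, lintegral_one, Measure.restrict_apply_univ, P]

lemma deficit_le_deficit_band {A B : Set (Fin (d + 1) → 𝕋)} (hA : MeasurableSet A)
    (hB : MeasurableSet B) {I J : Set 𝕋} (hI : MeasurableSet I) (hJ : MeasurableSet J)
    (hAI : volume.real A = volume.real I) (hBJ : volume.real B = volume.real J) {p q : ℝ}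
    (hpI : (fun r : ℝ => (r : 𝕋)) '' Icc p (p + volume.real I) ⊆ I)
    (hqJ : (fun r : ℝ => (r : 𝕋)) '' Icc q (q + volume.real J) ⊆ J)
    {t : ℝ} (ht : 0 ≤ t) (htB : t ≤ volume.real B) :
    deficit volume A B t ≤
      deficit volume {x : Fin (d + 1) → 𝕋 | x 0 ∈ I} {x | x 0 ∈ J} t := by
  rw [deficit_preimage_eval_zero hI hJ]
  rcases le_total (volume.real A) t with htA | htA
  · calc _ ≤ t - volume.real A * volume.real B := deficit_le_of_measureReal_le hA hB le_rfl htA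
      _ = t - volume.real I * volume.real J := by rw [hAI, hBJ]
      _ ≤ _ := le_deficit hI hJ t
  rcases le_total (volume.real A) (1 - volume.real B + t) with h | h
  · calc _ ≤ t * (1 - volume.real A - volume.real B + t) := deficit_le_mul hA hB ht htB htA h
      _ = t * (1 - volume.real I - volume.real J + t) := by rw [hAI, hBJ]
      _ ≤ _ := mul_le_deficit_of_image_coe_Icc_subset hI hJ ht (by rwa [← hAI])
        (by rwa [← hBJ]) (by linarith) hpI hqJ
  · exact (deficit_le_of_le_measureReal hA le_rfl (by linarith)).trans (deficit_nonneg _ _ _)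

lemma volume_band {I : Set 𝕋} (hI : MeasurableSet I) :
    volume {x : Fin (d + 1) → 𝕋 | x 0 ∈ I} = volume I :=
  measurePreserving_eval_zero.measure_preimage hI.nullMeasurableSet

lemma image_coe_Icc_measureReal_subset {u v : ℝ} (huv : u ≤ v) :
    (fun r : ℝ => (r : 𝕋)) '' Icc u (u + volume.real ((fun r : ℝ => (r : 𝕋)) '' Icc u v)) ⊆
      (fun r : ℝ => (r : 𝕋)) '' Icc u v := by
  refine image_mono (Icc_subset_Icc le_rfl ?_)
  have := ENNReal.toReal_mono ENNReal.ofReal_ne_top (volume_image_coe_Icc_le (u := u) (v := v))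
  rw [ENNReal.toReal_ofReal (by linarith)] at this
  simp only [measureReal_def]
  linarith

end ExpUnion

theorem stmt2 (d n : ℕ) (hn : 1 ≤ n)
    (A B : Set (Fin (d + 1) → 𝕋)) (hAm : MeasurableSet A) (hBm : MeasurableSet B)
    (hA0 : 0 < volume A) (hB0 : 0 < volume B)
    (a₁ a₂ b₁ b₂ : ℝ) (ha : a₁ ≤ a₂) (hb : b₁ ≤ b₂)
    (A' B' : Set (Fin (d + 1) → 𝕋))
    (hA' : A' = {x | x 0 ∈ (fun r : ℝ => (r : 𝕋)) '' Set.Icc a₁ a₂})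
    (hB' : B' = {x | x 0 ∈ (fun r : ℝ => (r : 𝕋)) '' Set.Icc b₁ b₂})
    (hvA : volume A' = volume A) (hvB : volume B' = volume B) :
    expUnionT (fun _ : Fin n => A) (fun _ => B) ≥
      expUnionT (fun _ : Fin n => A') (fun _ => B') := by
  have hI := measurableSet_image_coe_Icc a₁ a₂
  have hJ := measurableSet_image_coe_Icc b₁ b₂
  have hAm' : MeasurableSet A' := hA' ▸ measurePreserving_eval_zero.measurable hI
  have hBm' : MeasurableSet B' := hB' ▸ measurePreserving_eval_zero.measurable hJ
  have hrB : volume.real B' = volume.real B := by simp only [measureReal_def, hvB]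
  have hdef : ∀ t, 0 ≤ t → t ≤ volume.real B → deficit volume A B t ≤ deficit volume A' B' t := by
    intro t ht htB
    rw [hA', hB']
    refine deficit_le_deficit_band hAm hBm hI hJ ?_ ?_ (image_coe_Icc_measureReal_subset ha)
      (image_coe_Icc_measureReal_subset hb) ht htB
    · rw [measureReal_def, measureReal_def, ← hvA, hA', volume_band hI]
    · rw [measureReal_def, measureReal_def, ← hvB, hB', volume_band hJ]
  have hpow := integral_sub_pow_le (measurable_overlap hAm hBm) (measurable_overlap hAm' hBm')
    measureReal_nonneg overlap_nonneg overlap_le_right overlap_nonneg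
    (fun x => (overlap_le_right x).trans_eq hrB) hdef n
  have h := lintegral_volume_iUnion_add hAm hBm n
  have h' := lintegral_volume_iUnion_add hAm' hBm' n
  rw [hvB, hrB, ← h] at h'
  have hle : (∫⁻ b in Set.univ.pi (fun _ : Fin n => B'), volume (⋃ i, (· + b i) '' A')) ≤
      ∫⁻ b in Set.univ.pi (fun _ : Fin n => B), volume (⋃ i, (· + b i) '' A) := by
    refine (ENNReal.add_le_add_iff_right ENNReal.ofReal_ne_top).1 (h'.trans_le ?_)
    gcongr
  have hfin : (∫⁻ b in Set.univ.pi (fun _ : Fin n => B), volume (⋃ i, (· + b i) '' A)) ≠ ⊤ :=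
    ne_top_of_le_ne_top (ENNReal.pow_ne_top (measure_ne_top volume B)) (le_self_add.trans_eq h)
  unfold expUnionT
  simp only [Finset.prod_const, hvB]
  refine ENNReal.toReal_mono (ENNReal.mul_ne_top ?_ hfin) (by gcongr)
  exact ENNReal.inv_ne_top.2 (pow_ne_zero _ hB0.ne')
end

section
/- Let n ≥ 1 be an integer and p a prime. For 1 ≤ i ≤ n let f_i, g_i : {0, 1, …, p−1} → ℕ be increasing functions with the property that for every integer j ≥ 0, Σ_{x=0}^{p−1} max(0, f_i(x) − j) ≤ Σ_{x=0}^{p−1} max(0, g_i(x) − j). Then Σ_{x=0}^{p−1} ∏_{i=1}^n f_i(x) ≤ Σ_{x=0}^{p−1} ∏_{i=1}^n g_i(x). -/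
open Finset in
/-- Domination of all truncated sums gives domination of the sums over upper sets. -/
theorem sum_le_sum_of_isUpperSet {ι : Type*} [Fintype ι] [LinearOrder ι] {f g : ι → ℕ}
    (hg : Monotone g) (h : ∀ j, ∑ x, (f x - j) ≤ ∑ x, (g x - j))
    {s : Finset ι} (hs : IsUpperSet (s : Set ι)) : ∑ x ∈ s, f x ≤ ∑ x ∈ s, g x := by
  obtain rfl | hne := s.eq_empty_or_nonempty
  · simp
  set j := g (s.min' hne)
  have h_out : ∑ x ∈ s, (g x - j) = ∑ x, (g x - j) := by
    refine sum_subset (subset_univ s) fun x _ hx => Nat.sub_eq_zero_of_le (hg ?_)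
    by_contra! hlt
    exact hx (hs hlt.le (s.min'_mem hne))
  calc ∑ x ∈ s, f x ≤ ∑ x ∈ s, ((f x - j) + j) := sum_le_sum fun x _ => by omega
    _ = ∑ x ∈ s, (f x - j) + ∑ x ∈ s, j := sum_add_distrib
    _ ≤ ∑ x, (f x - j) + ∑ x ∈ s, j := by
      gcongr
      exact subset_univ s
    _ ≤ ∑ x ∈ s, (g x - j) + ∑ x ∈ s, j := by
      rw [h_out]
      gcongr ?_ + _
      exact h j
    _ = ∑ x ∈ s, ((g x - j) + j) := sum_add_distrib.symm
    _ = ∑ x ∈ s, g x :=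
      sum_congr rfl fun x hx => Nat.sub_add_cancel (hg (s.min'_le x hx))

open Finset in
/-- A weighted sum is the sum over `t` of the sums over the superlevel sets `{x | t < w x}`. -/
theorem sum_mul_eq_sum_superlevel {ι : Type*} [Fintype ι] (w f : ι → ℕ) {N : ℕ}
    (hN : ∀ x, w x ≤ N) :
    ∑ x, w x * f x = ∑ t ∈ range N, ∑ x with t < w x, f x := by
  simp_rw [sum_filter]
  rw [sum_comm]
  refine sum_congr rfl fun x _ => ?_
  have h_range : {t ∈ range N | t < w x} = range (w x) := by
    ext t
    have := hN x
    simp only [mem_filter, mem_range]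
    omega
  rw [← sum_filter, h_range, sum_const, card_range, smul_eq_mul]

open Finset in
/-- Domination of all truncated sums gives domination of the sums with a monotone weight. -/
theorem sum_mul_le_sum_mul_of_truncated {ι : Type*} [Fintype ι] [LinearOrder ι] {w f g : ι → ℕ}
    (hw : Monotone w) (hg : Monotone g) (h : ∀ j, ∑ x, (f x - j) ≤ ∑ x, (g x - j)) :
    ∑ x, w x * f x ≤ ∑ x, w x * g x := by
  have hN : ∀ x, w x ≤ univ.sup w := fun x => le_sup (mem_univ x)
  rw [sum_mul_eq_sum_superlevel w f hN, sum_mul_eq_sum_superlevel w g hN]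
  refine sum_le_sum fun t _ => sum_le_sum_of_isUpperSet hg h fun x y hxy hx => ?_
  simp only [coe_filter, mem_univ, true_and, Set.mem_ofPred_eq] at hx ⊢
  exact hx.trans_le (hw hxy)

open Finset in
theorem sum_mul_prod_le_sum_mul_prod_of_truncated {ι κ : Type*} [Fintype ι] [LinearOrder ι]
    {f g : κ → ι → ℕ} (s : Finset κ) (hf : ∀ i ∈ s, Monotone (f i))
    (hg : ∀ i ∈ s, Monotone (g i))
    (h : ∀ i ∈ s, ∀ j, ∑ x, (f i x - j) ≤ ∑ x, (g i x - j)) {w : ι → ℕ} (hw : Monotone w) :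
    ∑ x, w x * ∏ i ∈ s, f i x ≤ ∑ x, w x * ∏ i ∈ s, g i x := by
  classical
  induction s using Finset.induction_on generalizing w with
  | empty => simp
  | insert a s ha ih =>
    simp only [forall_mem_insert] at hf hg h
    simp only [prod_insert ha]
    have h_prod : Monotone fun x => w x * ∏ i ∈ s, g i x := fun x y hxy =>
      Nat.mul_le_mul (hw hxy) (prod_le_prod' fun i hi => hg.2 i hi hxy)
    calc ∑ x, w x * (f a x * ∏ i ∈ s, f i x) = ∑ x, (w x * f a x) * ∏ i ∈ s, f i x := by
          simp only [mul_assoc]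
      _ ≤ ∑ x, (w x * f a x) * ∏ i ∈ s, g i x :=
          ih hf.2 hg.2 h.2 fun x y hxy => Nat.mul_le_mul (hw hxy) (hf.1 hxy)
      _ = ∑ x, (w x * ∏ i ∈ s, g i x) * f a x := by simp only [mul_right_comm]
      _ ≤ ∑ x, (w x * ∏ i ∈ s, g i x) * g a x :=
          sum_mul_le_sum_mul_of_truncated h_prod hg.1 h.1
      _ = ∑ x, w x * (g a x * ∏ i ∈ s, g i x) :=
          sum_congr rfl fun x _ => by ring

theorem stmt5 (n p : ℕ) (hn : 1 ≤ n) (hp : p.Prime)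
    (f g : Fin n → Fin p → ℕ)
    (hf : ∀ i, Monotone (f i)) (hg : ∀ i, Monotone (g i))
    (h : ∀ i : Fin n, ∀ j : ℕ, ∑ x : Fin p, (f i x - j) ≤ ∑ x : Fin p, (g i x - j)) :
    ∑ x : Fin p, ∏ i : Fin n, f i x ≤ ∑ x : Fin p, ∏ i : Fin n, g i x := by
  simpa using sum_mul_prod_le_sum_mul_prod_of_truncated Finset.univ (fun i _ => hf i)
    (fun i _ => hg i) (fun i _ => h i) (monotone_const (c := 1))
end

section
/- There exist matrices M_j ∈ SL_2(ℤ) for j ∈ ℕ such that for every ε > 0 there exists N ∈ ℕ with the following property: for every measurable set X ⊆ T², for the band X' = [−c, c] × T with |X'| = |X|, and for every sequence of measurable sets (X_j)_{j≥0} with X_0 = X such that for each j the set X_{j+1} is a Steiner symmetrization of X_j with respect to M_j, one has |X_j △ X'| ≤ ε for all j ≥ N. -/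
open MeasureTheory
open scoped symmDiff

/-- The measure-preserving map of `𝕋^d` induced by an integer matrix `M`. -/
noncomputable def mmap {d : ℕ} (M : Matrix (Fin d) (Fin d) ℤ) (x : Fin d → 𝕋) : Fin d → 𝕋 :=
  fun i => ∑ j, M i j • x j

/-- `XM` is a Steiner symmetrization of `X` with respect to `M ∈ SL_2(ℤ)`: for almost
every `u ∈ 𝕋`, the section of `M(XM)` over `u` is a closed interval in `𝕋` centred at `0`
(possibly empty) whose measure equals that of the corresponding section of `M(X)`.
Here `𝕋²` is identified with `𝕋 × 𝕋` via `Fin.cons`. -/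
def IsSteinerT (M : Matrix (Fin 2) (Fin 2) ℤ) (X XM : Set (Fin 2 → 𝕋)) : Prop :=
  ∀ᵐ u : Fin 1 → 𝕋, ∃ c : ℝ, 0 ≤ c ∧ c ≤ 1 / 2 ∧
    ({x : 𝕋 | Fin.cons x u ∈ mmap M '' XM} = (fun r : ℝ => (r : 𝕋)) '' Set.Icc (-c) c ∨
      {x : 𝕋 | Fin.cons x u ∈ mmap M '' XM} = ∅) ∧
    volume {x : 𝕋 | Fin.cons x u ∈ mmap M '' XM} =
      volume {x : 𝕋 | Fin.cons x u ∈ mmap M '' X}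

/-- The band `[-c, c] × 𝕋` in `𝕋²`. -/
def band (c : ℝ) : Set (Fin 2 → 𝕋) :=
  {x | x 0 ∈ (fun r : ℝ => (r : 𝕋)) '' Set.Icc (-c) c}

/-- A subset of the circle is a centred arc if it is empty or a closed interval centred at `0`. -/
def IsCentredArc (s : Set 𝕋) : Prop :=
  s = ∅ ∨ ∃ c : ℝ, 0 ≤ c ∧ c ≤ 1 / 2 ∧ s = Metric.closedBall 0 c

instance inst_s9 : IsProbabilityMeasure (volume : Measure 𝕋) :=
  ⟨by simp [AddCircle.measure_univ]⟩

/-- The set of points `x` with `(x, u - r x) ∈ A`. -/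
def shearSection (r : ℤ) (A : Set (Fin 2 → 𝕋)) (u : 𝕋) : Set 𝕋 :=
  {x | ![x, u - r • x] ∈ A}

lemma coe_image_Icc_eq_closedBall (c : ℝ) :
    (fun r : ℝ => (r : 𝕋)) '' Set.Icc (-c) c = Metric.closedBall 0 c := by
  ext x
  induction x using QuotientAddGroup.induction_on with
  | H x =>
    simp only [Set.mem_image, Set.mem_Icc, mem_closedBall_zero_iff]
    constructor
    · rintro ⟨t, ht, hx⟩
      have hx' : ‖(x : 𝕋)‖ = ‖(t : 𝕋)‖ := by rw [← hx]
      refine hx'.trans_le ?_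
      rw [UnitAddCircle.norm_eq]
      have := round_le t 0
      simp only [Int.cast_zero, sub_zero] at this
      exact this.trans (abs_le.2 ht)
    · intro h
      have h' : |x - round x| ≤ c := by
        rw [← UnitAddCircle.norm_eq]; exact h
      refine ⟨x - round x, abs_le.1 h', ?_⟩
      have : ((round x : ℝ) : 𝕋) = 0 := by
        rw [AddCircle.coe_eq_zero_iff]
        exact ⟨round x, by simp⟩
      rw [AddCircle.coe_sub, this, sub_zero]

lemma measureReal_closedBall {c : ℝ} (h0 : 0 ≤ c) (h : c ≤ 1 / 2) (x : 𝕋) :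
    volume.real (Metric.closedBall x c) = 2 * c := by
  rw [measureReal_def, AddCircle.volume_closedBall, min_eq_right (by linarith),
    ENNReal.toReal_ofReal (by linarith)]

lemma IsCentredArc.measurableSet {s : Set 𝕋} (hs : IsCentredArc s) : MeasurableSet s := by
  obtain rfl | ⟨c, -, -, rfl⟩ := hs
  · exact .empty
  · exact Metric.isClosed_closedBall.measurableSet

/-- The number of integers in an interval of nonnegative length differs from the length by at
most one. -/
lemma abs_card_Icc_ceil_floor_sub_le {a b : ℝ} (h : a ≤ b) :
    |((Finset.Icc ⌈a⌉ ⌊b⌋).card : ℝ) - (b - a)| ≤ 1 := by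
  have h1 := Int.ceil_lt_add_one a
  have h2 := Int.le_ceil a
  have h3 := Int.floor_le b
  have h4 := Int.lt_floor_add_one b
  have h5 : 0 ≤ ⌊b⌋ + 1 - ⌈a⌉ := by
    have : (-1 : ℝ) < ((⌊b⌋ + 1 - ⌈a⌉ : ℤ) : ℝ) := by push_cast; linarith
    have : (-1 : ℤ) < ⌊b⌋ + 1 - ⌈a⌉ := by exact_mod_cast this
    omega
  have h6 : ((Finset.Icc ⌈a⌉ ⌊b⌋).card : ℝ) = ⌊b⌋ + 1 - ⌈a⌉ := by
    rw [Int.card_Icc, ← Int.cast_natCast, Int.toNat_of_nonneg h5]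
    push_cast
    ring
  rw [h6, abs_le]
  constructor <;> linarith

open Classical in
/-- The orbit of a point near `-1/2` under the rotation by `1/R` equidistributes in centred
balls with discrepancy at most one. -/
lemma abs_card_filter_closedBall_sub_le_of_mem_Ico {R : ℕ} (hR : 0 < R) {c : ℝ} (h0 : 0 ≤ c)
    (h : c < 1 / 2) {t : ℝ} (ht : t ∈ Set.Ico (-1 / 2 : ℝ) (-1 / 2 + 1 / R)) :
    |(((Finset.range R).filter fun k : ℕ =>
      ((t + k / R : ℝ) : 𝕋) ∈ Metric.closedBall 0 c).card : ℝ) - R * (2 * c)| ≤ 1 := by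
  have hR' : (0 : ℝ) < R := by exact_mod_cast hR
  obtain ⟨ht1, ht2⟩ := ht
  have hmem : ∀ k : ℕ, k < R →
      (((t + k / R : ℝ) : 𝕋) ∈ Metric.closedBall (0 : 𝕋) c ↔
        R * (-c - t) ≤ k ∧ (k : ℝ) ≤ R * (c - t)) := by
    intro k hk
    have hk' : (k : ℝ) + 1 ≤ R := by exact_mod_cast hk
    have e : (k : ℝ) / R + 1 / R ≤ 1 := by rw [← add_div, div_le_one hR']; exact hk'
    have e0 : 0 ≤ (k : ℝ) / R := by positivity
    have habs : |t + k / R| ≤ |(1 : ℝ)| / 2 := by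
      rw [abs_one, abs_le]; constructor <;> linarith
    rw [mem_closedBall_zero_iff, (AddCircle.norm_coe_eq_abs_iff 1 one_ne_zero).2 habs, abs_le]
    have e1 : (k : ℝ) = R * (k / R) := by field_simp
    constructor
    · rintro ⟨h1, h2⟩
      constructor
      · rw [e1]; exact mul_le_mul_of_nonneg_left (by linarith) hR'.le
      · rw [e1]; exact mul_le_mul_of_nonneg_left (by linarith) hR'.le
    · rintro ⟨h1, h2⟩
      rw [e1] at h1 h2
      have h1 := le_of_mul_le_mul_left h1 hR'
      have h2 := le_of_mul_le_mul_left h2 hR'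
      constructor <;> linarith
  have hcard : ((Finset.range R).filter fun k : ℕ =>
      ((t + k / R : ℝ) : 𝕋) ∈ Metric.closedBall 0 c).card =
      (Finset.Icc ⌈R * (-c - t)⌉ ⌊R * (c - t)⌋).card := by
    refine Finset.card_bij (fun k _ => (k : ℤ)) ?_ ?_ ?_
    · intro k hk
      rw [Finset.mem_filter, Finset.mem_range] at hk
      have := (hmem k hk.1).1 hk.2
      rw [Finset.mem_Icc, Int.ceil_le, Int.le_floor]
      exact_mod_cast this
    · intro a _ b _ hab
      exact_mod_cast hab
    · intro k hk
      rw [Finset.mem_Icc, Int.ceil_le, Int.le_floor] at hk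
      have ha : (-1 : ℝ) < k := by
        refine lt_of_lt_of_le ?_ hk.1
        have : R * (-(1 / R)) < R * (-c - t) := mul_lt_mul_of_pos_left (by linarith) hR'
        have e : (R : ℝ) * (-(1 / R)) = -1 := by field_simp
        linarith
      have hb : (k : ℝ) < R := by
        refine lt_of_le_of_lt hk.2 ?_
        have : R * (c - t) < R * 1 := mul_lt_mul_of_pos_left (by linarith) hR'
        linarith
      have ha' : (-1 : ℤ) < k := by exact_mod_cast ha
      have hb' : k < R := by exact_mod_cast hb
      lift k to ℕ using by omega
      have hk' : k < R := by exact_mod_cast hb'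
      refine ⟨k, ?_, rfl⟩
      rw [Finset.mem_filter, Finset.mem_range]
      exact ⟨hk', (hmem k hk').2 (by exact_mod_cast hk)⟩
  rw [hcard]
  have := abs_card_Icc_ceil_floor_sub_le
    (mul_le_mul_of_nonneg_left (by linarith : -c - t ≤ c - t) hR'.le)
  convert this using 3
  ring

open Classical in
/-- Every orbit of the rotation by `1/R` equidistributes in centred arcs with discrepancy at most
one. -/
lemma abs_card_filter_sub_measureReal_le {R : ℕ} (hR : 0 < R) {s : Set 𝕋} (hs : IsCentredArc s)
    (x : 𝕋) :
    |(((Finset.range R).filter fun k : ℕ =>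
      x + ((k / R : ℝ) : 𝕋) ∈ s).card : ℝ) - R * volume.real s| ≤ 1 := by
  have hR' : (0 : ℝ) < R := by exact_mod_cast hR
  obtain rfl | ⟨c, h0, h, rfl⟩ := hs
  · simp
  rw [measureReal_closedBall h0 h]
  obtain rfl | h := h.eq_or_lt
  · have hu : Metric.closedBall (0 : 𝕋) (1 / 2) = Set.univ :=
      AddCircle.closedBall_eq_univ_of_half_period_le 1 one_ne_zero 0 (by simp)
    rw [hu]
    simp
  obtain ⟨y, hy, rfl⟩ : ∃ y ∈ Set.Ico (-1 / 2 : ℝ) (-1 / 2 + 1), (y : 𝕋) = x := by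
    have := AddCircle.coe_image_Ico_eq (1 : ℝ) (-1 / 2)
    exact (Set.ext_iff.1 this x).2 trivial
  set m : ℕ := ⌊(y + 1 / 2) * R⌋₊ with hm
  have hnn : 0 ≤ (y + 1 / 2) * R := mul_nonneg (by linarith [hy.1]) hR'.le
  have hm1 := Nat.floor_le hnn
  have hm2 := Nat.lt_floor_add_one ((y + 1 / 2) * R)
  rw [← hm] at hm1 hm2
  set p : ℕ → Prop := fun k => ((y - m / R + k / R : ℝ) : 𝕋) ∈ Metric.closedBall 0 c with hp
  have hper : Function.Periodic p R := by
    intro k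
    have e : y - m / R + ((k + R : ℕ) : ℝ) / R = y - m / R + k / R + 1 := by
      push_cast; field_simp; ring
    simp only [hp]
    rw [e, AddCircle.coe_add_period]
  have hcount := Nat.filter_Ico_card_eq_of_periodic m R p hper
  rw [Nat.count_eq_card_filter_range] at hcount
  have hshift : ((Finset.range R).filter fun k : ℕ =>
      (y : 𝕋) + ((k / R : ℝ) : 𝕋) ∈ Metric.closedBall 0 c).card =
      ((Finset.Ico m (m + R)).filter p).card := by
    refine Finset.card_bij (fun k _ => m + k) ?_ ?_ ?_
    · intro k hk
      simp only [Finset.mem_filter, Finset.mem_range, Finset.mem_Ico, hp] at hk ⊢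
      refine ⟨by omega, ?_⟩
      rw [← AddCircle.coe_add] at hk
      convert hk.2 using 2
      push_cast; field_simp; ring
    · intro a _ b _ hab
      simpa using hab
    · intro k hk
      simp only [Finset.mem_filter, Finset.mem_Ico, hp] at hk
      obtain ⟨k, rfl⟩ := Nat.exists_eq_add_of_le hk.1.1
      refine ⟨k, ?_, rfl⟩
      simp only [Finset.mem_filter, Finset.mem_range]
      refine ⟨by omega, ?_⟩
      rw [← AddCircle.coe_add]
      convert hk.2 using 2
      push_cast; field_simp; ring
  rw [hshift, hcount]
  refine abs_card_filter_closedBall_sub_le_of_mem_Ico hR h0 h ⟨?_, ?_⟩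
  · have : (m : ℝ) / R ≤ y + 1 / 2 := (div_le_iff₀ hR').2 hm1
    linarith
  · have : y + 1 / 2 < (m + 1 : ℝ) / R := (lt_div_iff₀ hR').2 hm2
    rw [add_div] at this
    linarith

lemma measurePreserving_sub_nsmul {R : ℕ} (hR : 1 < R) (u : 𝕋) :
    MeasurePreserving (fun x : 𝕋 => u - R • x) volume volume :=
  (Measure.measurePreserving_sub_left volume u).comp
    (AddCircle.ergodic_nsmul (T := (1 : ℝ)) hR).toMeasurePreserving

lemma integral_comp_sub_nsmul {R : ℕ} (hR : 1 < R) (u : 𝕋) {f : 𝕋 → ℝ} (hf : Measurable f) :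
    ∫ x, f (u - R • x) = ∫ x, f x := by
  have h := measurePreserving_sub_nsmul hR u
  rw [← integral_map h.measurable.aemeasurable hf.aestronglyMeasurable, h.map_eq]

lemma ae_sub_nsmul {R : ℕ} (hR : 1 < R) (u : 𝕋) {p : 𝕋 → Prop} (hp : ∀ᵐ x, p x) :
    ∀ᵐ x, p (u - R • x) :=
  (measurePreserving_sub_nsmul hR u).quasiMeasurePreserving.ae hp

lemma measureReal_eq_integral_section {D : Set (𝕋 × 𝕋)} (hD : MeasurableSet D) :
    volume.real D = ∫ v : 𝕋, volume.real (Prod.mk v ⁻¹' D) := by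
  have := integral_prod (μ := (volume : Measure 𝕋)) (ν := (volume : Measure 𝕋))
    (D.indicator (1 : 𝕋 × 𝕋 → ℝ)) ((integrable_const (1 : ℝ)).indicator hD)
  rw [integral_indicator_one hD] at this
  refine this.trans (integral_congr_ae (.of_forall fun v => ?_))
  exact integral_indicator_one (measurable_prodMk_left hD)

/-- Slicing a set with centred arcs as fibres along a steep direction gives sections of almost
constant measure. -/
lemma abs_measureReal_slice_sub_le {R : ℕ} (hR : 1 < R) {D : Set (𝕋 × 𝕋)}
    (hD : MeasurableSet D) (harc : ∀ᵐ v : 𝕋, IsCentredArc (Prod.mk v ⁻¹' D)) (u : 𝕋) :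
    |volume.real {x : 𝕋 | (u - R • x, x) ∈ D} - volume.real D| ≤ 1 / R := by
  classical
  have hR' : (0 : ℝ) < R := by exact_mod_cast zero_lt_one.trans hR
  have hmp := measurePreserving_sub_nsmul hR u
  have hmeas : Measurable fun x : 𝕋 => (u - R • x, x) := hmp.measurable.prodMk measurable_id
  have hslice : MeasurableSet {x : 𝕋 | (u - R • x, x) ∈ D} := hmeas hD
  obtain ⟨g, hg⟩ : ∃ g : 𝕋 → ℝ, g = {x : 𝕋 | (u - R • x, x) ∈ D}.indicator 1 := ⟨_, rfl⟩
  have hF : volume.real {x : 𝕋 | (u - R • x, x) ∈ D} = ∫ x, g x := by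
    rw [hg]
    exact (integral_indicator_one hslice).symm
  have hgi : Integrable g := hg ▸ (integrable_const (1 : ℝ)).indicator hslice
  have hav : (R : ℝ) * volume.real {x : 𝕋 | (u - R • x, x) ∈ D} =
      ∫ x, ∑ k ∈ Finset.range R, g (x + ((k / R : ℝ) : 𝕋)) := by
    rw [integral_finsetSum _ fun k _ => hgi.comp_add_right _]
    simp only [integral_add_right_eq_self, hF, Finset.sum_const, Finset.card_range, nsmul_eq_mul]
  have hsum : ∀ x, ∑ k ∈ Finset.range R, g (x + ((k / R : ℝ) : 𝕋)) =
      (((Finset.range R).filter fun k : ℕ =>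
        x + ((k / R : ℝ) : 𝕋) ∈ Prod.mk (u - R • x) ⁻¹' D).card : ℝ) := by
    intro x
    rw [Finset.card_filter]
    push_cast
    refine Finset.sum_congr rfl fun k _ => ?_
    have e : R • ((k / R : ℝ) : 𝕋) = 0 := by
      rw [← AddCircle.coe_nsmul, nsmul_eq_mul, mul_div_cancel₀ _ hR'.ne',
        AddCircle.coe_eq_zero_iff]
      exact ⟨k, by simp⟩
    simp only [hg, Set.indicator_apply, Set.mem_ofPred_eq, Set.mem_preimage, smul_add, e, add_zero,
      Pi.one_apply]
  have hsec : Measurable fun v : 𝕋 => volume.real (Prod.mk v ⁻¹' D) :=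
    (measurable_measure_prodMk_left hD).ennreal_toReal
  have hvol : volume.real D = ∫ x : 𝕋, volume.real (Prod.mk (u - R • x) ⁻¹' D) := by
    rw [measureReal_eq_integral_section hD]
    exact (integral_comp_sub_nsmul hR u hsec).symm
  have hvi : Integrable fun x : 𝕋 => volume.real (Prod.mk (u - R • x) ⁻¹' D) :=
    Integrable.of_bound (hsec.comp hmp.measurable).aestronglyMeasurable 1 (.of_forall fun v => by
      rw [Real.norm_of_nonneg measureReal_nonneg]; exact measureReal_le_one)
  have hgsi : Integrable fun x => ∑ k ∈ Finset.range R, g (x + ((k / R : ℝ) : 𝕋)) :=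
    integrable_finsetSum _ fun k _ => hgi.comp_add_right _
  have hae : ∀ᵐ x : 𝕋, IsCentredArc (Prod.mk (u - R • x) ⁻¹' D) :=
    ae_sub_nsmul (p := fun v => IsCentredArc (Prod.mk v ⁻¹' D)) hR u harc
  have key : |(R : ℝ) * volume.real {x : 𝕋 | (u - R • x, x) ∈ D} - R * volume.real D| ≤ 1 := by
    rw [hav, hvol, ← integral_const_mul, ← integral_sub hgsi (hvi.const_mul _)]
    have := norm_integral_le_of_norm_le_const (μ := (volume : Measure 𝕋)) (C := 1)
      (f := fun x : 𝕋 => ∑ k ∈ Finset.range R, g (x + ((k / R : ℝ) : 𝕋)) -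
        R * volume.real (Prod.mk (u - R • x) ⁻¹' D)) (by
          filter_upwards [hae] with x hx
          rw [hsum, Real.norm_eq_abs]
          exact abs_card_filter_sub_measureReal_le (zero_lt_one.trans hR) hx x)
    simpa using this
  rw [← mul_sub, abs_mul, abs_of_pos hR'] at key
  rw [le_div_iff₀ hR']
  linarith

/-- Centred arcs are nested, so they are determined up to null sets by their measure. -/
lemma IsCentredArc.measureReal_symmDiff {s t : Set 𝕋} (hs : IsCentredArc s)
    (ht : IsCentredArc t) :
    volume.real (s ∆ t) = |volume.real s - volume.real t| := by
  wlog hst : s ⊆ t generalizing s t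
  · have hts : t ⊆ s := by
      obtain rfl | ⟨c, -, -, rfl⟩ := hs
      · exact absurd (Set.empty_subset t) hst
      obtain rfl | ⟨d, -, -, rfl⟩ := ht
      · exact Set.empty_subset _
      · refine Metric.closedBall_subset_closedBall (le_of_not_ge fun h => hst ?_)
        exact Metric.closedBall_subset_closedBall h
    rw [symmDiff_comm, this ht hs hts, abs_sub_comm]
  rw [symmDiff_of_le hst, measureReal_sdiff hst hs.measurableSet, abs_sub_comm,
    abs_of_nonneg (sub_nonneg.2 (measureReal_mono hst))]

/-- The shear `(x, y) ↦ (x, y + r x)`. -/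
def shear (r : ℤ) : Matrix (Fin 2) (Fin 2) ℤ := !![1, 0; r, 1]

lemma setOf_cons_mem_mmap_shear_image (r : ℤ) (A : Set (Fin 2 → 𝕋)) (u : Fin 1 → 𝕋) :
    {x : 𝕋 | (Fin.cons x u : Fin 2 → 𝕋) ∈ mmap (shear r) '' A} = shearSection r A (u 0) := by
  have hmmap : ∀ a : Fin 2 → 𝕋, mmap (shear r) a = ![a 0, r • a 0 + a 1] := by
    intro a
    ext i
    fin_cases i <;> simp [mmap, shear, Fin.sum_univ_two]
  ext x
  simp only [Set.mem_ofPred_eq, shearSection, Set.mem_image, hmmap]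
  constructor
  · rintro ⟨a, ha, h⟩
    have h0 : a 0 = x := congrFun h 0
    have h1 : r • a 0 + a 1 = u 0 := congrFun h 1
    convert ha
    ext i
    fin_cases i
    · exact h0.symm
    · simp [← h1, h0]
  · intro h
    refine ⟨_, h, ?_⟩
    ext i
    fin_cases i
    · rfl
    · simp

lemma shearSection_band (r : ℤ) (c : ℝ) (u : 𝕋) :
    shearSection r (band c) u = Metric.closedBall 0 c := by
  rw [← coe_image_Icc_eq_closedBall]
  rfl

/-- The set of pairs `(u, x)` with `x` in the section of `A` over `u`. -/
def shearSet (r : ℤ) (A : Set (Fin 2 → 𝕋)) : Set (𝕋 × 𝕋) :=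
  {p | p.2 ∈ shearSection r A p.1}

lemma measurePreserving_shear (r : ℤ) :
    MeasurePreserving (fun p : 𝕋 × 𝕋 => (![p.2, p.1 - r • p.2] : Fin 2 → 𝕋)) volume volume := by
  have h1 : MeasurePreserving (fun p : 𝕋 × 𝕋 => (p.1, p.2 - r • p.1))
      ((volume : Measure 𝕋).prod volume) ((volume : Measure 𝕋).prod volume) := by
    refine MeasurePreserving.skew_product (g := fun x y => y - r • x)
      (MeasurePreserving.id volume) ?_ (.of_forall fun x => ?_)
    · exact (continuous_snd.sub (continuous_fst.zsmul r)).measurable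
    · exact (measurePreserving_sub_right volume (r • x)).map_eq
  exact ((volume_preserving_finTwoArrow 𝕋).symm.comp h1).comp Measure.measurePreserving_swap

lemma measurableSet_shearSet (r : ℤ) {A : Set (Fin 2 → 𝕋)} (hA : MeasurableSet A) :
    MeasurableSet (shearSet r A) :=
  (measurePreserving_shear r).measurable hA

lemma measureReal_shearSet (r : ℤ) {A : Set (Fin 2 → 𝕋)} (hA : MeasurableSet A) :
    volume.real (shearSet r A) = volume.real A :=
  (measurePreserving_shear r).measureReal_preimage hA.nullMeasurableSet

lemma measureReal_eq_integral_shearSection (r : ℤ) {A : Set (Fin 2 → 𝕋)} (hA : MeasurableSet A) :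
    volume.real A = ∫ u : 𝕋, volume.real (shearSection r A u) := by
  rw [← measureReal_shearSet r hA, measureReal_eq_integral_section (measurableSet_shearSet r hA)]
  rfl

lemma IsSteinerT.ae_shearSection {r : ℤ} {X Y : Set (Fin 2 → 𝕋)} (h : IsSteinerT (shear r) X Y) :
    ∀ᵐ u : 𝕋, IsCentredArc (shearSection r Y u) ∧
      volume.real (shearSection r Y u) = volume.real (shearSection r X u) := by
  have h' := (volume_preserving_funUnique (Fin 1) 𝕋).symm.quasiMeasurePreserving.ae h
  filter_upwards [h'] with u hu
  simp only [setOf_cons_mem_mmap_shear_image, coe_image_Icc_eq_closedBall] at hu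
  obtain ⟨c, h0, h1, harc, hvol⟩ := hu
  exact ⟨harc.symm.imp id fun h => ⟨c, h0, h1, h⟩, congrArg ENNReal.toReal hvol⟩

lemma IsSteinerT.measureReal_eq {r : ℤ} {X Y : Set (Fin 2 → 𝕋)} (h : IsSteinerT (shear r) X Y)
    (hX : MeasurableSet X) (hY : MeasurableSet Y) : volume.real Y = volume.real X := by
  rw [measureReal_eq_integral_shearSection r hX, measureReal_eq_integral_shearSection r hY]
  exact integral_congr_ae (h.ae_shearSection.mono fun u hu => hu.2)

lemma measurableSet_band (c : ℝ) : MeasurableSet (band c) := by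
  unfold band
  rw [coe_image_Icc_eq_closedBall]
  exact measurable_pi_apply 0 Metric.isClosed_closedBall.measurableSet

lemma measureReal_band {c : ℝ} (h0 : 0 ≤ c) (h : c ≤ 1 / 2) : volume.real (band c) = 2 * c := by
  rw [measureReal_eq_integral_shearSection 0 (measurableSet_band c)]
  simp [shearSection_band, measureReal_closedBall h0 h]

/-- Two consecutive Steiner symmetrizations along shears whose slopes differ by `R` bring every
set within distance `1 / R` of the band of the same measure. -/
lemma measureReal_symmDiff_band_le {r : ℤ} {R : ℕ} (hR : 1 < R) {X Y Z : Set (Fin 2 → 𝕋)}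
    (hY : MeasurableSet Y) (hZ : MeasurableSet Z) (hXY : IsSteinerT (shear r) X Y)
    (hYZ : IsSteinerT (shear (r + R)) Y Z) {c : ℝ} (h0 : 0 ≤ c) (h : c ≤ 1 / 2)
    (hc : volume.real Y = 2 * c) :
    volume.real (Z ∆ band c) ≤ 1 / R := by
  have hslice : ∀ u : 𝕋, |volume.real (shearSection (r + R) Y u) - 2 * c| ≤ 1 / R := by
    intro u
    have := abs_measureReal_slice_sub_le hR (measurableSet_shearSet r hY)
      (hXY.ae_shearSection.mono fun v hv => hv.1) u
    rw [measureReal_shearSet r hY, hc] at this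
    have e : {x : 𝕋 | (u - R • x, x) ∈ shearSet r Y} = shearSection (r + R) Y u := by
      ext x
      simp only [shearSet, shearSection, Set.mem_ofPred_eq]
      rw [add_smul, natCast_zsmul, sub_sub, add_comm (R • x)]
    rwa [e] at this
  rw [measureReal_eq_integral_shearSection (r + R) (hZ.symmDiff (measurableSet_band c))]
  have hbound : ∀ᵐ u : 𝕋, ‖volume.real (shearSection (r + R) (Z ∆ band c) u)‖ ≤ 1 / R := by
    filter_upwards [hYZ.ae_shearSection] with u hu
    have e : shearSection (r + R) (Z ∆ band c) u =
        shearSection (r + R) Z u ∆ Metric.closedBall 0 c := by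
      rw [← shearSection_band (r + R) c u]
      rfl
    rw [e, hu.1.measureReal_symmDiff (.inr ⟨c, h0, h, rfl⟩), measureReal_closedBall h0 h, hu.2,
      Real.norm_eq_abs, abs_abs]
    exact hslice u
  have := norm_integral_le_of_norm_le_const hbound
  rw [probReal_univ, mul_one] at this
  exact (le_abs_self _).trans this

theorem stmt9 :
    ∃ M : ℕ → Matrix (Fin 2) (Fin 2) ℤ, (∀ j, (M j).det = 1) ∧
      ∀ ε : ℝ, 0 < ε → ∃ N : ℕ,
        ∀ X : Set (Fin 2 → 𝕋), MeasurableSet X →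
          ∀ c : ℝ, 0 ≤ c → c ≤ 1 / 2 → volume (band c) = volume X →
            ∀ Xs : ℕ → Set (Fin 2 → 𝕋), Xs 0 = X → (∀ j, MeasurableSet (Xs j)) →
              (∀ j, IsSteinerT (M j) (Xs j) (Xs (j + 1))) →
              ∀ j, N ≤ j → (volume (Xs j ∆ band c)).toReal ≤ ε := by
  refine ⟨fun j => shear ((j : ℤ) ^ 2), fun j => by simp [shear, Matrix.det_fin_two], ?_⟩
  intro ε hε
  obtain ⟨n, hn⟩ := exists_nat_one_div_lt hε
  refine ⟨n + 3, ?_⟩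
  rintro X hX c h0 h1 hvol Xs rfl hmeas hst j hj
  obtain ⟨i, rfl⟩ : ∃ i, j = i + 2 := ⟨j - 2, by omega⟩
  have hconst : ∀ k, volume.real (Xs k) = 2 * c := by
    intro k
    induction k with
    | zero => rw [← measureReal_band h0 h1]; exact congrArg ENNReal.toReal hvol.symm
    | succ k ih => rw [(hst k).measureReal_eq (hmeas k) (hmeas (k + 1)), ih]
  have hstep : IsSteinerT (shear ((i : ℤ) ^ 2 + (2 * i + 1 : ℕ))) (Xs (i + 1)) (Xs (i + 2)) := by
    have e : ((i + 1 : ℕ) : ℤ) ^ 2 = (i : ℤ) ^ 2 + (2 * i + 1 : ℕ) := by push_cast; ring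
    rw [← e]
    exact hst (i + 1)
  refine (measureReal_symmDiff_band_le (by omega) (hmeas _) (hmeas _) (hst i) hstep h0 h1
    (hconst _)).trans (le_trans ?_ hn.le)
  have hni : (n : ℝ) + 1 ≤ i := by exact_mod_cast (by omega : n + 1 ≤ i)
  push_cast
  exact one_div_le_one_div_of_le (by positivity) (by linarith)
end

section
/- Let d, n ≥ 1 be integers, let M ∈ SL_d(ℝ), and let X and Y be measurable subsets of ℝ^d of finite positive Lebesgue measure. Let X^M and Y^M be Steiner symmetrizations of X and Y with respect to M. Then for points y_1, …, y_n chosen independently and uniformly at random from Y, and y^M_1, …, y^M_n chosen independently and uniformly at random from Y^M, one has E(|⋃_{i=1}^n (X + y_i)|) ≥ E(|⋃_{i=1}^n (X^M + y^M_i)|). -/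
open MeasureTheory

/-- `XM` is a Steiner symmetrization of `X ⊆ ℝ^{d+1}` with respect to `M ∈ SL_{d+1}(ℝ)`:
for almost every `u ∈ ℝ^d`, the section of `M(XM)` over `u` is a closed interval in `ℝ`
centred at `0` (possibly empty) whose measure equals that of the corresponding section
of `M(X)`. Here `ℝ^{d+1}` is identified with `ℝ × ℝ^d` via `Fin.cons`. -/
def IsSteinerR {d : ℕ} (M : Matrix (Fin (d + 1)) (Fin (d + 1)) ℝ)
    (X XM : Set (Fin (d + 1) → ℝ)) : Prop :=
  ∀ᵐ u : Fin d → ℝ, ∃ c : ℝ, 0 ≤ c ∧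
    ({x : ℝ | Fin.cons x u ∈ M.mulVec '' XM} = Set.Icc (-c) c ∨
      {x : ℝ | Fin.cons x u ∈ M.mulVec '' XM} = ∅) ∧
    volume {x : ℝ | Fin.cons x u ∈ M.mulVec '' XM} =
      volume {x : ℝ | Fin.cons x u ∈ M.mulVec '' X}

/-- The expected volume of `⋃ i, (X i + y i)` when each `y i` is chosen independently
and uniformly at random from `Y i`. -/
noncomputable def expUnionR {d n : ℕ} (X Y : Fin n → Set (Fin d → ℝ)) : ℝ :=
  ((∏ i, volume (Y i))⁻¹ *
    ∫⁻ y in Set.univ.pi Y, volume (⋃ i, (· + y i) '' (X i))).toReal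


open Filter Topology Set
open scoped ENNReal

/-- The convolution of the indicator functions of two sets in an additive group. -/
noncomputable def setConv {G : Type*} [MeasurableSpace G] [Sub G] (μ : Measure G)
    (A B : Set G) (z : G) : ℝ≥0∞ :=
  μ {a | a ∈ A ∧ z - a ∈ B}

section Group

variable {G : Type*} [MeasurableSpace G] [AddGroup G]
  {μ : Measure G} {A B : Set G}

theorem setConv_le_left (μ : Measure G) (A B : Set G) (z : G) : setConv μ A B z ≤ μ A :=
  measure_mono fun _ ha => ha.1

variable [MeasurableSub₂ G]

theorem measurableSet_setConv (hA : MeasurableSet A) (hB : MeasurableSet B) :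
    MeasurableSet {p : G × G | p.2 ∈ A ∧ p.1 - p.2 ∈ B} :=
  (measurable_snd hA).inter ((measurable_fst.sub measurable_snd) hB)

theorem measurable_setConv [SFinite μ] (hA : MeasurableSet A) (hB : MeasurableSet B) :
    Measurable (setConv μ A B) :=
  measurable_measure_prodMk_left (measurableSet_setConv hA hB)

theorem lintegral_setConv [MeasurableAdd G] [SFinite μ] [μ.IsAddRightInvariant]
    (hA : MeasurableSet A) (hB : MeasurableSet B) :
    ∫⁻ z, setConv μ A B z ∂μ = μ A * μ B := by
  have hS := measurableSet_setConv hA hB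
  have h1 : ∫⁻ z, setConv μ A B z ∂μ = (μ.prod μ) {p : G × G | p.2 ∈ A ∧ p.1 - p.2 ∈ B} := by
    rw [Measure.prod_apply hS]; rfl
  rw [h1, Measure.prod_apply_symm hS]
  have h2 : ∀ a, μ ((fun x => (x, a)) ⁻¹' {p : G × G | p.2 ∈ A ∧ p.1 - p.2 ∈ B})
      = A.indicator (fun _ => μ B) a := by
    intro a
    by_cases ha : a ∈ A
    · have h3 : (fun x => (x, a)) ⁻¹' {p : G × G | p.2 ∈ A ∧ p.1 - p.2 ∈ B}
          = (fun x => x - a) ⁻¹' B := by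
        ext x; simp [ha]
      rw [h3, indicator_of_mem ha,
        (measurePreserving_sub_right μ a).measure_preimage hB.nullMeasurableSet]
    · simp [ha]
  simp_rw [h2]
  rw [lintegral_indicator_const hA, mul_comm]

end Group

section Line

variable {A B : Set ℝ}

theorem exists_volume_inter_Iic_eq (hA : volume A ≠ ⊤) (hAm : MeasurableSet A)
    {t : ℝ≥0∞} (ht : 0 < t) (htA : t < volume A) : ∃ x, volume (A ∩ Iic x) = t := by
  have key : ∀ (l : Filter ℝ) [l.IsCountablyGenerated] (C : Set ℝ), MeasurableSet C →
      (∀ᵐ a : ℝ, ∀ᶠ x in l, a ∈ A ∩ Iic x ↔ a ∈ C) →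
      Tendsto (fun x => volume (A ∩ Iic x)) l (𝓝 (volume C)) := fun l _ C hC h =>
    tendsto_measure_of_ae_tendsto_indicator l hC (fun x => hAm.inter measurableSet_Iic)
      hAm hA (Eventually.of_forall fun x => inter_subset_left) h
  refine mem_range_of_exists_le_of_exists_ge (f := fun x => volume (A ∩ Iic x)) ?_ ?_ ?_
  · refine continuous_iff_continuousAt.2 fun x => key _ _ (hAm.inter measurableSet_Iic) ?_
    have : ∀ᵐ a : ℝ, a ≠ x := by simp [ae_iff]
    filter_upwards [this] with a ha
    rcases lt_or_gt_of_ne ha with h | h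
    · filter_upwards [lt_mem_nhds h] with y hy
      simp [h.le, le_of_lt hy]
    · filter_upwards [gt_mem_nhds h] with y hy
      simp [hy.not_ge, h.not_ge]
  · have h := key atBot ∅ MeasurableSet.empty (Eventually.of_forall fun a => by
      filter_upwards [Iio_mem_atBot a] with y hy
      simp only [mem_Iio] at hy
      simp [hy])
    rw [measure_empty] at h
    exact (h.eventually (gt_mem_nhds ht)).exists.imp fun _ => le_of_lt
  · have h := key atTop A hAm (Eventually.of_forall fun a => by
      filter_upwards [Ici_mem_atTop a] with y hy
      simp only [mem_Ici] at hy
      simp [hy])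
    exact (h.eventually (lt_mem_nhds htA)).exists.imp fun _ => le_of_lt

theorem setConv_le_right (A B : Set ℝ) (z : ℝ) : setConv volume A B z ≤ volume B := by
  refine (measure_mono fun _ ha => ha.2).trans_eq ?_
  exact (Measure.measurePreserving_sub_left volume z).measure_preimage_emb
    (MeasurableEquiv.subLeft z).measurableEmbedding B

/-- A continuous analogue of Pollard's theorem: the truncated convolution of two sets of reals. -/
theorem lintegral_setConv_sub_le (hAm : MeasurableSet A) (hBm : MeasurableSet B)
    (hA : volume A ≠ ⊤) (hB : volume B ≠ ⊤) (t : ℝ≥0∞) :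
    ∫⁻ x, (setConv volume A B x - t) ≤ (volume A - t) * (volume B - t) := by
  rcases le_or_gt (volume A) t with h | htA
  · simp [tsub_eq_zero_of_le ((setConv_le_left volume A B _).trans h)]
  rcases le_or_gt (volume B) t with h | htB
  · simp [tsub_eq_zero_of_le ((setConv_le_right A B _).trans h)]
  rcases eq_or_ne t 0 with rfl | ht
  · simp [lintegral_setConv hAm hBm]
  have ht0 : 0 < t := pos_iff_ne_zero.2 ht
  have htt : t ≠ ⊤ := htA.ne_top
  obtain ⟨a, ha⟩ := exists_volume_inter_Iic_eq hA hAm ht0 htA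
  obtain ⟨b, hb⟩ := exists_volume_inter_Iic_eq hB hBm (tsub_pos_of_lt htB)
    (ENNReal.sub_lt_self hB (ht0.trans htB).ne' ht)
  have hA' : volume (A ∩ Ioi a) = volume A - t := by
    rw [← ha]
    refine ENNReal.eq_sub_of_add_eq (ha ▸ htt) ?_
    rw [add_comm, ← measure_inter_add_sdiff A (measurableSet_Iic (a := a))]
    congr 2
    ext; simp
  have hB' : volume (B ∩ Ioi b) = t := by
    have h := measure_inter_add_sdiff (μ := volume) B (measurableSet_Iic (a := b))
    have h2 : B \ Iic b = B ∩ Ioi b := by ext; simp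
    rw [hb, h2] at h
    have h3 : volume B - t + t = volume B := tsub_add_cancel_of_le htB.le
    exact (ENNReal.add_right_inj (ENNReal.sub_ne_top hB)).1 (h.trans h3.symm)
  rw [← hA', ← hb, ← lintegral_setConv (hAm.inter measurableSet_Ioi) (hBm.inter measurableSet_Iic)]
  refine lintegral_mono fun z => ?_
  rw [tsub_le_iff_right]
  rcases le_or_gt (z - b) a with h | h
  · refine le_trans (measure_mono (t := {x | x ∈ A ∩ Ioi a ∧ z - x ∈ B ∩ Iic b} ∪ A ∩ Iic a) ?_)
      ((measure_union_le _ _).trans_eq (by rw [ha]; rfl))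
    rintro x ⟨hx, hzx⟩
    rcases le_or_gt x a with h2 | h2
    · exact Or.inr ⟨hx, h2⟩
    · exact Or.inl ⟨⟨hx, h2⟩, hzx, by simp only [mem_Iic]; linarith⟩
  · refine le_trans (measure_mono (t := {x | x ∈ A ∩ Ioi a ∧ z - x ∈ B ∩ Iic b} ∪
      {x | x ∈ univ ∧ z - x ∈ B ∩ Ioi b}) ?_) ((measure_union_le _ _).trans
      (add_le_add le_rfl ((setConv_le_right _ _ _).trans_eq hB')))
    rintro x ⟨hx, hzx⟩
    rcases le_or_gt (z - x) b with h2 | h2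
    · exact Or.inl ⟨⟨hx, by simp only [mem_Ioi]; linarith⟩, hzx, h2⟩
    · exact Or.inr ⟨trivial, hzx, h2⟩

end Line
section Centred

/-- A set of reals that is empty or a closed interval centred at the origin. -/
def IsCentredInterval (A : Set ℝ) : Prop :=
  A = ∅ ∨ ∃ c, 0 ≤ c ∧ A = Icc (-c) c

theorem setConv_Icc (c e z : ℝ) :
    setConv volume (Icc (-c) c) (Icc (-e) e) z
      = ENNReal.ofReal (min (min (2 * c) (2 * e)) (c + e - |z|)) := by
  have h : {a | a ∈ Icc (-c) c ∧ z - a ∈ Icc (-e) e} = Icc (max (-c) (z - e)) (min c (z + e)) := by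
    ext a
    simp only [mem_Icc, mem_ofPred_eq, max_le_iff, le_min_iff]
    constructor <;> rintro ⟨⟨_, _⟩, _, _⟩ <;> refine ⟨⟨?_, ?_⟩, ?_, ?_⟩ <;> linarith
  rw [setConv, h, Real.volume_Icc]
  congr 1
  rcases abs_cases z with ⟨h, _⟩ | ⟨h, _⟩ <;> rw [h] <;> simp only [min_def, max_def] <;> grind

theorem lintegral_trapezoid (c e : ℝ) :
    ∫⁻ z : ℝ, ENNReal.ofReal (min (min (2 * c) (2 * e)) (c + e - |z|))
      = ENNReal.ofReal (2 * c) * ENNReal.ofReal (2 * e) := by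
  simp_rw [← setConv_Icc]
  rw [lintegral_setConv measurableSet_Icc measurableSet_Icc, Real.volume_Icc, Real.volume_Icc]
  ring_nf

theorem IsCentredInterval.setConv_eq {A B : Set ℝ}
    (hA : IsCentredInterval A) (hB : IsCentredInterval B) :
    ∃ c e : ℝ, 0 ≤ c ∧ 0 ≤ e ∧ volume A = ENNReal.ofReal (2 * c) ∧
      volume B = ENNReal.ofReal (2 * e) ∧
      ∀ z, setConv volume A B z
        = ENNReal.ofReal (min (min (2 * c) (2 * e)) (c + e - |z|)) := by
  rcases hA with rfl | ⟨c, hc, rfl⟩ <;> rcases hB with rfl | ⟨e, he, rfl⟩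
  · refine ⟨0, 0, le_rfl, le_rfl, by simp, by simp, fun z => ?_⟩
    rw [ENNReal.ofReal_of_nonpos (by simp)]
    simp [setConv]
  · refine ⟨0, e, le_rfl, he, by simp, by rw [Real.volume_Icc]; ring_nf, fun z => ?_⟩
    rw [ENNReal.ofReal_of_nonpos (by simp)]
    simp [setConv]
  · refine ⟨c, 0, hc, le_rfl, by rw [Real.volume_Icc]; ring_nf, by simp, fun z => ?_⟩
    rw [ENNReal.ofReal_of_nonpos (by simp)]
    simp [setConv]
  · exact ⟨c, e, hc, he, by rw [Real.volume_Icc]; ring_nf, by rw [Real.volume_Icc]; ring_nf,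
      setConv_Icc c e⟩

variable {A B : Set ℝ}

theorem IsCentredInterval.volume_ne_top (hA : IsCentredInterval A) : volume A ≠ ⊤ := by
  rcases hA with rfl | ⟨c, -, rfl⟩ <;> simp

theorem IsCentredInterval.continuous_setConv (hA : IsCentredInterval A)
    (hB : IsCentredInterval B) : Continuous (setConv volume A B) := by
  obtain ⟨c, e, -, -, -, -, h⟩ := hA.setConv_eq hB
  rw [funext h]
  exact ENNReal.continuous_ofReal.comp (by fun_prop)

theorem IsCentredInterval.setConv_anti (hA : IsCentredInterval A)
    (hB : IsCentredInterval B) {x y : ℝ} (hxy : |x| ≤ |y|) :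
    setConv volume A B y ≤ setConv volume A B x := by
  obtain ⟨c, e, -, -, -, -, h⟩ := hA.setConv_eq hB
  rw [h, h]
  gcongr

theorem IsCentredInterval.setConv_zero (hA : IsCentredInterval A)
    (hB : IsCentredInterval B) : setConv volume A B 0 = min (volume A) (volume B) := by
  obtain ⟨c, e, -, -, hA, hB, h⟩ := hA.setConv_eq hB
  rw [h, hA, hB, ← ENNReal.ofReal_min, min_eq_left]
  rcases le_total c e with h | h
  · exact (min_le_left _ _).trans (by simp; linarith)
  · exact (min_le_right _ _).trans (by simp; linarith)

theorem IsCentredInterval.tendsto_setConv_atTop (hA : IsCentredInterval A)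
    (hB : IsCentredInterval B) : Tendsto (setConv volume A B) atTop (𝓝 0) := by
  obtain ⟨c, e, -, -, -, -, h⟩ := hA.setConv_eq hB
  refine tendsto_const_nhds.congr' ?_
  filter_upwards [Ici_mem_atTop (c + e)] with z hz
  rw [h, ENNReal.ofReal_of_nonpos]
  exact (min_le_right _ _).trans (by linarith [le_abs_self z, mem_Ici.1 hz])

theorem IsCentredInterval.le_lintegral_setConv_sub (hA : IsCentredInterval A)
    (hB : IsCentredInterval B) (t : ℝ≥0∞) :
    (volume A - t) * (volume B - t) ≤ ∫⁻ x, (setConv volume A B x - t) := by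
  rcases le_or_gt (volume A) t with h | htA
  · simp [tsub_eq_zero_of_le h]
  rcases le_or_gt (volume B) t with h | htB
  · simp [tsub_eq_zero_of_le h]
  obtain ⟨c, e, hc, he, hA, hB, h⟩ := hA.setConv_eq hB
  lift t to NNReal using htA.ne_top
  rw [hA, ENNReal.lt_ofReal_iff_toReal_lt (by simp)] at htA
  rw [hB, ENNReal.lt_ofReal_iff_toReal_lt (by simp)] at htB
  simp only [ENNReal.coe_toReal] at htA htB
  have ht : (t : ℝ≥0∞) = ENNReal.ofReal t := by simp
  simp_rw [hA, hB, h, ht, ← ENNReal.ofReal_sub _ t.coe_nonneg]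
  have := lintegral_trapezoid (c - t / 2) (e - t / 2)
  rw [show 2 * c - t = 2 * (c - t / 2) by ring, show 2 * e - t = 2 * (e - t / 2) by ring, ← this]
  refine lintegral_mono fun z => ENNReal.ofReal_le_ofReal ?_
  rw [← min_sub_sub_right, ← min_sub_sub_right]
  exact le_of_eq (by ring_nf)

end Centred

section Family

variable {V : Type*} [MeasurableSpace V] {ν : Measure V} [SFinite ν] {A B A' B' : Set (ℝ × V)}

/-- The integral over a parameter of the convolutions of the sections of two sets. -/
noncomputable def sectionConv (ν : Measure V) (A B : Set (ℝ × V)) (z : ℝ) : ℝ≥0∞ :=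
  ∫⁻ v, setConv volume ((fun a => (a, v)) ⁻¹' A) ((fun a => (a, v)) ⁻¹' B) z ∂ν

theorem measurable_setConv_section (hA : MeasurableSet A) (hB : MeasurableSet B) :
    Measurable fun p : ℝ × V =>
      setConv volume ((fun a => (a, p.2)) ⁻¹' A) ((fun a => (a, p.2)) ⁻¹' B) p.1 := by
  have : MeasurableSet {q : (ℝ × V) × ℝ | (q.2, q.1.2) ∈ A ∧ (q.1.1 - q.2, q.1.2) ∈ B} :=
    (hA.preimage (by fun_prop : Measurable fun q : (ℝ × V) × ℝ => (q.2, q.1.2))).inter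
      (hB.preimage (by fun_prop : Measurable fun q : (ℝ × V) × ℝ => (q.1.1 - q.2, q.1.2)))
  exact measurable_measure_prodMk_left this

theorem measurable_sectionConv (hA : MeasurableSet A) (hB : MeasurableSet B) :
    Measurable (sectionConv ν A B) :=
  (measurable_setConv_section hA hB).lintegral_prod_right'

theorem lintegral_sectionConv (hA : MeasurableSet A) (hB : MeasurableSet B) :
    ∫⁻ z, sectionConv ν A B z = ∫⁻ v, volume ((fun a => (a, v)) ⁻¹' A) *
      volume ((fun a => (a, v)) ⁻¹' B) ∂ν := by
  unfold sectionConv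
  rw [lintegral_lintegral_swap (measurable_setConv_section hA hB).aemeasurable]
  exact lintegral_congr fun v => lintegral_setConv (measurable_prodMk_right hA)
    (measurable_prodMk_right hB)

variable (hA : MeasurableSet A) (hB : MeasurableSet B)
    (hA' : MeasurableSet A') (hB' : MeasurableSet B')
    (hAc : ∀ᵐ v ∂ν, IsCentredInterval ((fun a => (a, v)) ⁻¹' A') ∧
      volume ((fun a => (a, v)) ⁻¹' A') = volume ((fun a => (a, v)) ⁻¹' A))
    (hBc : ∀ᵐ v ∂ν, IsCentredInterval ((fun a => (a, v)) ⁻¹' B') ∧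
      volume ((fun a => (a, v)) ⁻¹' B') = volume ((fun a => (a, v)) ⁻¹' B))
    (hfin : ((volume : Measure ℝ).prod ν) A' ≠ ⊤)

include hfin hA' hB' in
theorem tendsto_sectionConv {l : Filter ℝ} [l.IsCountablyGenerated] {g : V → ℝ≥0∞}
    (h : ∀ᵐ v ∂ν, Tendsto (setConv volume ((fun a => (a, v)) ⁻¹' A') ((fun a => (a, v)) ⁻¹' B')) l
      (𝓝 (g v))) :
    Tendsto (sectionConv ν A' B') l (𝓝 (∫⁻ v, g v ∂ν)) := by
  refine tendsto_lintegral_filter_of_dominated_convergence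
    (fun v => volume ((fun a => (a, v)) ⁻¹' A')) (Eventually.of_forall fun x => ?_)
    (Eventually.of_forall fun x => Eventually.of_forall fun v => setConv_le_left _ _ _ _) ?_ h
  · exact (measurable_setConv_section hA' hB').comp measurable_prodMk_left
  · rwa [← Measure.prod_apply_symm hA']

include hA hB hA' hB' hAc hBc hfin in
theorem lintegral_sectionConv_sub_le {t : ℝ≥0∞} (ht : 0 < t) :
    ∫⁻ z, (sectionConv ν A B z - t) ≤ ∫⁻ z, (sectionConv ν A' B' z - t) := by
  rcases le_or_gt (sectionConv ν A' B' 0) t with h0 | h0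
  · refine le_of_eq_of_le ?_ zero_le
    simp only [lintegral_eq_zero_iff ((measurable_sectionConv hA hB).sub_const t)]
    refine Eventually.of_forall fun z => tsub_eq_zero_of_le (le_trans (lintegral_mono_ae ?_) h0)
    filter_upwards [hAc, hBc] with v ⟨h1, h2⟩ ⟨h3, h4⟩
    rw [h1.setConv_zero h3, h2, h4]
    exact le_min (setConv_le_left _ _ _ _) (setConv_le_right _ _ _)
  have hcont : Continuous (sectionConv ν A' B') := continuous_iff_continuousAt.2 fun x => by
    refine tendsto_sectionConv hA' hB' hfin ?_
    filter_upwards [hAc, hBc] with v ⟨h1, _⟩ ⟨h3, _⟩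
    exact (h1.continuous_setConv h3).tendsto x
  have hlim : Tendsto (sectionConv ν A' B') atTop (𝓝 0) := by
    rw [← lintegral_zero (μ := ν)]
    refine tendsto_sectionConv hA' hB' hfin ?_
    filter_upwards [hAc, hBc] with v ⟨h1, _⟩ ⟨h3, _⟩
    exact h1.tendsto_setConv_atTop h3
  obtain ⟨x, rfl⟩ : t ∈ range (sectionConv ν A' B') :=
    mem_range_of_exists_le_of_exists_ge hcont
      ((hlim.eventually (gt_mem_nhds ht)).exists.imp fun _ => le_of_lt) ⟨0, h0.le⟩
  set τ : V → ℝ≥0∞ := fun v =>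
    setConv volume ((fun a => (a, v)) ⁻¹' A') ((fun a => (a, v)) ⁻¹' B') x with hτ
  have hm := measurable_setConv_section hA hB
  have hm' := measurable_setConv_section hA' hB'
  have hτm : Measurable τ := hm'.comp measurable_prodMk_left
  have hτfin : ∫⁻ v, τ v ∂ν ≠ ⊤ := by
    refine ne_top_of_le_ne_top hfin ?_
    rw [Measure.prod_apply_symm hA']
    exact lintegral_mono fun v => setConv_le_left _ _ _ _
  calc ∫⁻ z, (sectionConv ν A B z - sectionConv ν A' B' x)
      ≤ ∫⁻ z, ∫⁻ v, (setConv volume ((fun a => (a, v)) ⁻¹' A) ((fun a => (a, v)) ⁻¹' B) z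
          - τ v) ∂ν := lintegral_mono fun z => lintegral_sub_le _ _ hτm
    _ = ∫⁻ v, (∫⁻ z, (setConv volume ((fun a => (a, v)) ⁻¹' A) ((fun a => (a, v)) ⁻¹' B) z
          - τ v)) ∂ν := lintegral_lintegral_swap (hm.sub (hτm.comp measurable_snd)).aemeasurable
    _ ≤ ∫⁻ v, (∫⁻ z, (setConv volume ((fun a => (a, v)) ⁻¹' A') ((fun a => (a, v)) ⁻¹' B') z
          - τ v)) ∂ν := by
        refine lintegral_mono_ae ?_
        filter_upwards [hAc, hBc] with v ⟨h1, h2⟩ ⟨h3, h4⟩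
        refine (lintegral_setConv_sub_le (measurable_prodMk_right hA) (measurable_prodMk_right hB)
          (h2 ▸ h1.volume_ne_top) (h4 ▸ h3.volume_ne_top) _).trans ?_
        rw [← h2, ← h4]
        exact h1.le_lintegral_setConv_sub h3 _
    _ = ∫⁻ z, ∫⁻ v, (setConv volume ((fun a => (a, v)) ⁻¹' A') ((fun a => (a, v)) ⁻¹' B') z
          - τ v) ∂ν :=
        (lintegral_lintegral_swap (hm'.sub (hτm.comp measurable_snd)).aemeasurable).symm
    _ ≤ ∫⁻ z, (sectionConv ν A' B' z - sectionConv ν A' B' x) := by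
        refine lintegral_mono fun z => ?_
        rcases le_total |z| |x| with h | h
        · refine (lintegral_sub' hτm.aemeasurable hτfin ?_).le
          filter_upwards [hAc, hBc] with v ⟨h1, _⟩ ⟨h3, _⟩
          exact h1.setConv_anti h3 h
        · refine le_of_eq_of_le ?_ zero_le
          refine (lintegral_congr_ae ?_).trans lintegral_zero
          filter_upwards [hAc, hBc] with v ⟨h1, _⟩ ⟨h3, _⟩
          exact tsub_eq_zero_of_le (h1.setConv_anti h3 h)

include hA hB hA' hB' hAc hBc hfin in
theorem lintegral_min_sectionConv_le (t : ℝ≥0∞) (hf : ∫⁻ z, sectionConv ν A' B' z ≠ ⊤) :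
    ∫⁻ z, min (sectionConv ν A' B' z) t ≤ ∫⁻ z, min (sectionConv ν A B z) t := by
  rcases eq_or_ne t 0 with rfl | ht
  · simp
  have hs : ∀ C D : Set (ℝ × V), MeasurableSet C → MeasurableSet D → ∫⁻ z, sectionConv ν C D z =
      (∫⁻ z, (sectionConv ν C D z - t)) + ∫⁻ z, min (sectionConv ν C D z) t := by
    intro C D hC hD
    rw [← lintegral_add_left ((measurable_sectionConv hC hD).sub_const t)]
    simp only [tsub_add_min]
  have heq : ∫⁻ z, sectionConv ν A' B' z = ∫⁻ z, sectionConv ν A B z := by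
    rw [lintegral_sectionConv hA' hB', lintegral_sectionConv hA hB]
    refine lintegral_congr_ae ?_
    filter_upwards [hAc, hBc] with v ⟨_, h2⟩ ⟨_, h4⟩
    rw [h2, h4]
  have hle := lintegral_sectionConv_sub_le hA hB hA' hB' hAc hBc hfin (pos_iff_ne_zero.2 ht)
  have hne : ∫⁻ z, (sectionConv ν A' B' z - t) ≠ ⊤ :=
    ne_top_of_le_ne_top hf (lintegral_mono fun z => tsub_le_self)
  rw [hs A' B' hA' hB', hs A B hA hB] at heq
  refine (ENNReal.add_le_add_iff_left hne).1 ?_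
  rw [heq]
  gcongr

end Family

section Concave

theorem integral_min_mul_pow (k : ℕ) {m s : ℝ} (hs : 0 ≤ s) (hsm : s ≤ m) :
    ∫ t in (0)..m, (k + 2) * (k + 1) * (m - t) ^ k * min s t = m ^ (k + 2) - (m - s) ^ (k + 2) := by
  have hi : ∀ a b : ℝ, IntervalIntegrable
      (fun t => (k + 2) * (k + 1) * (m - t) ^ k * min s t) volume a b := fun a b =>
    Continuous.intervalIntegrable (by fun_prop) a b
  rw [← intervalIntegral.integral_add_adjacent_intervals (hi 0 s) (hi s m)]
  have h1 : ∫ t in (0)..s, (k + 2) * (k + 1) * (m - t) ^ k * min s t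
      = ∫ t in (0)..s, (k + 2) * (k + 1) * (m - t) ^ k * t := by
    refine intervalIntegral.integral_congr fun t ht => ?_
    rw [uIcc_of_le hs] at ht
    simp only [min_eq_right ht.2]
  have h2 : ∫ t in s..m, (k + 2) * (k + 1) * (m - t) ^ k * min s t
      = ∫ t in s..m, (k + 2) * (k + 1) * (m - t) ^ k * s := by
    refine intervalIntegral.integral_congr fun t ht => ?_
    rw [uIcc_of_le hsm] at ht
    simp only [min_eq_left ht.1]
  have hp : ∀ (j : ℕ) (t : ℝ), HasDerivAt (fun t => (m - t) ^ (j + 1)) (-((j + 1) * (m - t) ^ j)) t := by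
    intro j t
    have h := ((hasDerivAt_id' t).const_sub m).fun_pow (j + 1)
    rw [Nat.add_sub_cancel] at h
    exact h.congr_deriv (by push_cast; ring)
  rw [h1, h2, intervalIntegral.integral_eq_sub_of_hasDerivAt
      (f := fun t => -(k + 2) * (t * (m - t) ^ (k + 1)) - (m - t) ^ (k + 2)) ?_
      (Continuous.intervalIntegrable (by fun_prop) _ _),
    intervalIntegral.integral_eq_sub_of_hasDerivAt
      (f := fun t => -(k + 2) * s * (m - t) ^ (k + 1)) ?_
      (Continuous.intervalIntegrable (by fun_prop) _ _)]
  · simp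
    ring
  · intro t _
    exact ((hp k t).const_mul (-(k + 2 : ℝ) * s)).congr_deriv (by ring)
  · intro t _
    exact ((((hasDerivAt_id' t).fun_mul (hp k t)).const_mul (-(k + 2) : ℝ)).fun_sub
      (hp (k + 1) t)).congr_deriv (by push_cast; ring)

theorem lintegral_mul_min (k : ℕ) {m s : ℝ≥0∞} (hm : m ≠ ⊤) (hsm : s ≤ m) :
    m ^ (k + 2) - (m - s) ^ (k + 2) = ∫⁻ t in Ioc 0 m.toReal,
      ENNReal.ofReal ((k + 2) * (k + 1) * (m.toReal - t) ^ k) * min s (ENNReal.ofReal t) := by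
  have hs := ne_top_of_le_ne_top hm hsm
  have hle : s.toReal ≤ m.toReal := ENNReal.toReal_mono hm hsm
  have h := integral_min_mul_pow k s.toReal_nonneg hle
  rw [intervalIntegral.integral_of_le m.toReal_nonneg] at h
  have hnn : ∀ t ∈ Ioc 0 m.toReal, 0 ≤ (k + 2) * (k + 1) * (m.toReal - t) ^ k := fun t ht => by
    have := sub_nonneg.2 ht.2
    positivity
  have h2 : ENNReal.ofReal (m.toReal ^ (k + 2) - (m.toReal - s.toReal) ^ (k + 2))
      = m ^ (k + 2) - (m - s) ^ (k + 2) := by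
    rw [ENNReal.ofReal_sub _ (pow_nonneg (sub_nonneg.2 hle) _),
      ENNReal.ofReal_pow m.toReal_nonneg, ENNReal.ofReal_pow (sub_nonneg.2 hle),
      ENNReal.ofReal_sub _ s.toReal_nonneg, ENNReal.ofReal_toReal hm, ENNReal.ofReal_toReal hs]
  rw [← h2, ← h, ofReal_integral_eq_lintegral_ofReal]
  · refine setLIntegral_congr_fun measurableSet_Ioc fun t ht => ?_
    rw [ENNReal.ofReal_mul (hnn t ht), ENNReal.ofReal_min, ENNReal.ofReal_toReal hs]
  · exact (Continuous.intervalIntegrable (by fun_prop) 0 m.toReal).1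
  · refine (ae_restrict_iff' measurableSet_Ioc).2 (Eventually.of_forall fun t ht => ?_)
    exact mul_nonneg (hnn t ht) (le_min s.toReal_nonneg ht.1.le)

theorem lintegral_pow_sub_pow_mono {α : Type*} [MeasurableSpace α] {μ : Measure α} [SFinite μ]
    {f g : α → ℝ≥0∞} (hf : Measurable f) (hg : Measurable g) {m : ℝ≥0∞} (hm : m ≠ ⊤)
    (hfm : ∀ x, f x ≤ m) (hgm : ∀ x, g x ≤ m) {n : ℕ} (hn : n ≠ 0)
    (h : ∀ t, ∫⁻ x, min (f x) t ∂μ ≤ ∫⁻ x, min (g x) t ∂μ) :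
    ∫⁻ x, (m ^ n - (m - f x) ^ n) ∂μ ≤ ∫⁻ x, (m ^ n - (m - g x) ^ n) ∂μ := by
  rcases n with _ | _ | k
  · exact absurd rfl hn
  · simpa [ENNReal.sub_sub_cancel hm, hfm, hgm] using h m
  · have key : ∀ u : α → ℝ≥0∞, Measurable u → (∀ x, u x ≤ m) →
        ∫⁻ x, (m ^ (k + 2) - (m - u x) ^ (k + 2)) ∂μ = ∫⁻ t in Ioc 0 m.toReal,
          ENNReal.ofReal ((k + 2) * (k + 1) * (m.toReal - t) ^ k) *
            ∫⁻ x, min (u x) (ENNReal.ofReal t) ∂μ := by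
      intro u hu hum
      simp_rw [fun x => lintegral_mul_min k hm (hum x)]
      rw [lintegral_lintegral_swap (by fun_prop)]
      exact lintegral_congr fun t => lintegral_const_mul _ (hu.min measurable_const)
    rw [key f hf hfm, key g hg hgm]
    exact lintegral_mono fun t => mul_le_mul_right (h _) _

end Concave

section Product

variable {V : Type*} [MeasurableSpace V] [AddCommGroup V] [TopologicalSpace V]
  [IsTopologicalAddGroup V] [SecondCountableTopology V] [BorelSpace V]
  {ν : Measure V} [SFinite ν]
  {X Y X' Y' : Set (ℝ × V)}

theorem setConv_prod_eq_sectionConv (hX : MeasurableSet X) (hY : MeasurableSet Y) (x : ℝ) (w : V) :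
    setConv (volume.prod ν) Y X (x, w) = sectionConv ν Y ((fun p => (p.1, w - p.2)) ⁻¹' X) x := by
  have hS : MeasurableSet {p | p ∈ Y ∧ (x, w) - p ∈ X} :=
    hY.inter (measurable_const_sub (x, w) hX)
  rw [setConv, Measure.prod_apply_symm hS]
  rfl

theorem lintegral_pow_sub_setConv_le [ν.IsAddLeftInvariant] [ν.IsNegInvariant]
    (hX : MeasurableSet X) (hY : MeasurableSet Y)
    (hX' : MeasurableSet X') (hY' : MeasurableSet Y')
    (hXc : ∀ᵐ v ∂ν, IsCentredInterval ((fun a => (a, v)) ⁻¹' X') ∧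
      volume ((fun a => (a, v)) ⁻¹' X') = volume ((fun a => (a, v)) ⁻¹' X))
    (hYc : ∀ᵐ v ∂ν, IsCentredInterval ((fun a => (a, v)) ⁻¹' Y') ∧
      volume ((fun a => (a, v)) ⁻¹' Y') = volume ((fun a => (a, v)) ⁻¹' Y))
    {m : ℝ≥0∞} (hm : m ≠ ⊤) (hYm : (volume.prod ν) Y = m) (hYm' : (volume.prod ν) Y' = m)
    (hXfin : (volume.prod ν) X' ≠ ⊤) {n : ℕ} (hn : n ≠ 0) :
    ∫⁻ z, (m ^ n - (m - setConv (volume.prod ν) Y' X' z) ^ n) ∂(volume.prod ν) ≤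
      ∫⁻ z, (m ^ n - (m - setConv (volume.prod ν) Y X z) ^ n) ∂(volume.prod ν) := by
  have hmeas : ∀ {C D : Set (ℝ × V)}, MeasurableSet C → MeasurableSet D →
      Measurable (setConv (volume.prod ν) C D) := fun hC hD => measurable_setConv hC hD
  rw [lintegral_prod_symm _ (by have := hmeas hY' hX'; fun_prop),
    lintegral_prod_symm _ (by have := hmeas hY hX; fun_prop)]
  have hfin : ∀ᵐ w ∂ν, ∫⁻ x, setConv (volume.prod ν) Y' X' (x, w) < ⊤ := by
    refine ae_lt_top (hmeas hY' hX').lintegral_prod_left' ?_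
    rw [← lintegral_prod_symm _ (hmeas hY' hX').aemeasurable, lintegral_setConv hY' hX', hYm']
    exact ENNReal.mul_ne_top hm hXfin
  refine lintegral_mono_ae ?_
  filter_upwards [hfin] with w hw
  have hr : Measurable fun p : ℝ × V => (p.1, w - p.2) := by fun_prop
  refine lintegral_pow_sub_pow_mono ((hmeas hY' hX').comp measurable_prodMk_right)
    ((hmeas hY hX).comp measurable_prodMk_right) hm
    (fun x => (setConv_le_left _ _ _ _).trans_eq hYm')
    (fun x => (setConv_le_left _ _ _ _).trans_eq hYm) hn fun t => ?_
  simp only [setConv_prod_eq_sectionConv hX' hY'] at hw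
  simp only [Function.comp_apply, setConv_prod_eq_sectionConv hX' hY',
    setConv_prod_eq_sectionConv hX hY]
  exact lintegral_min_sectionConv_le hY (hr hX) hY' (hr hX') hYc
    ((Measure.measurePreserving_sub_left ν w).quasiMeasurePreserving.ae hXc)
    (hYm' ▸ hm) t hw.ne

end Product

section Union

theorem mem_iUnion_image_add {G ι : Type*} [AddGroup G] {X : Set G} {y : ι → G} {z : G} :
    z ∈ ⋃ i, (· + y i) '' X ↔ ∃ i, z - y i ∈ X := by
  simp [sub_eq_add_neg]

theorem setLIntegral_volume_iUnion {k n : ℕ} {X Y : Set (Fin k → ℝ)}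
    (hX : MeasurableSet X) (hY : MeasurableSet Y) (hYfin : volume Y ≠ ⊤) :
    ∫⁻ y in univ.pi fun _ : Fin n => Y, volume (⋃ i, (· + y i) '' X)
      = ∫⁻ z, (volume Y ^ n - (volume Y - setConv volume Y X z) ^ n) := by
  have hpi : MeasurableSet (univ.pi fun _ : Fin n => Y) := MeasurableSet.univ_pi fun _ => hY
  have hS : MeasurableSet {p : (Fin n → Fin k → ℝ) × (Fin k → ℝ) | ∃ i, p.2 - p.1 i ∈ X} := by
    have : {p : (Fin n → Fin k → ℝ) × (Fin k → ℝ) | ∃ i, p.2 - p.1 i ∈ X}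
        = ⋃ i, (fun p => p.2 - p.1 i) ⁻¹' X := by ext; simp
    rw [this]
    exact MeasurableSet.iUnion fun i => hX.preimage (by fun_prop)
  have h1 : ∀ y : Fin n → Fin k → ℝ, volume (⋃ i, (· + y i) '' X) =
      volume (Prod.mk y ⁻¹' {p : (Fin n → Fin k → ℝ) × (Fin k → ℝ) | ∃ i, p.2 - p.1 i ∈ X}) := by
    intro y
    congr 1
    ext z
    rw [mem_iUnion_image_add]
    rfl
  simp_rw [h1]
  rw [← Measure.prod_apply hS, Measure.prod_apply_symm hS]
  refine lintegral_congr fun z => ?_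
  have hZ : MeasurableSet {a | a ∈ Y ∧ z - a ∈ X} := hY.inter (measurable_const_sub z hX)
  have hD : volume (Y \ {a | a ∈ Y ∧ z - a ∈ X}) = volume Y - setConv volume Y X z :=
    measure_sdiff (fun _ h => h.1) hZ.nullMeasurableSet
      (ne_top_of_le_ne_top hYfin (setConv_le_left _ _ _ _))
  have hset : (fun y : Fin n → Fin k → ℝ => (y, z)) ⁻¹' {p | ∃ i, p.2 - p.1 i ∈ X} ∩
      (univ.pi fun _ : Fin n => Y) =
      (univ.pi fun _ : Fin n => Y) \ univ.pi fun _ : Fin n => Y \ {a | a ∈ Y ∧ z - a ∈ X} := by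
    ext y
    simp only [mem_inter_iff, mem_preimage, mem_ofPred_eq, Set.mem_pi, mem_univ, true_imp_iff,
      Set.mem_sdiff, not_and]
    grind
  rw [Measure.restrict_apply (measurable_prodMk_right hS), hset, measure_sdiff, volume_pi_pi,
    volume_pi_pi, hD]
  · simp
  · exact pi_mono fun _ _ => Set.sdiff_subset
  · exact (MeasurableSet.univ_pi fun _ => hY.diff hZ).nullMeasurableSet
  · rw [volume_pi_pi, hD]
    exact ENNReal.prod_ne_top fun _ _ => ENNReal.sub_ne_top hYfin

theorem setLIntegral_volume_iUnion_ne_top {k n : ℕ} {X Y : Set (Fin k → ℝ)}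
    (hXfin : volume X ≠ ⊤) (hYfin : volume Y ≠ ⊤) :
    ∫⁻ y in univ.pi fun _ : Fin n => Y, volume (⋃ i, (· + y i) '' X) ≠ ⊤ := by
  have h : ∀ y : Fin n → Fin k → ℝ, volume (⋃ i, (· + y i) '' X) ≤ n * volume X := fun y =>
    (measure_iUnion_fintype_le _ _).trans_eq (by simp)
  refine ne_top_of_le_ne_top ?_ (lintegral_mono h)
  rw [setLIntegral_const, volume_pi_pi]
  exact ENNReal.mul_ne_top (ENNReal.mul_ne_top (by simp) hXfin)
    (ENNReal.prod_ne_top fun _ _ => hYfin)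

end Union

theorem setConv_image {G H : Type*} [MeasurableSpace G] [AddGroup G] [MeasurableSpace H]
    [AddGroup H] {μ : Measure G} {ν : Measure H} (L : G ≃ᵐ H) (hL : MeasurePreserving L μ ν)
    (hsub : ∀ a b, L (a - b) = L a - L b) (A B : Set G) (z : G) :
    setConv ν (L '' A) (L '' B) (L z) = setConv μ A B z := by
  rw [setConv, setConv, ← hL.measure_preimage_equiv]
  congr 1
  ext a
  simp [← hsub]

theorem exists_sections_equiv {d : ℕ} (M : Matrix (Fin (d + 1)) (Fin (d + 1)) ℝ) (hM : M.det = 1) :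
    ∃ L : (Fin (d + 1) → ℝ) ≃ᵐ ℝ × (Fin d → ℝ),
      MeasurePreserving L volume (volume.prod volume) ∧ (∀ a b, L (a - b) = L a - L b) ∧
      ∀ (X : Set (Fin (d + 1) → ℝ)) (u : Fin d → ℝ),
        {x : ℝ | Fin.cons x u ∈ M.mulVec '' X} = (fun x => (x, u)) ⁻¹' (L '' X) := by
  let e : (Fin (d + 1) → ℝ) ≃ₗ[ℝ] (Fin (d + 1) → ℝ) :=
    M.toLinearEquiv' (M.invertibleOfIsUnitDet (by simp [hM]))
  let E : (Fin (d + 1) → ℝ) ≃ᵐ (Fin (d + 1) → ℝ) :=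
    e.toContinuousLinearEquiv.toHomeomorph.toMeasurableEquiv
  let P := MeasurableEquiv.piFinSuccAbove (fun _ : Fin (d + 1) => ℝ) 0
  have hE : ∀ a, E a = M.mulVec a := fun a => rfl
  have hEmp : MeasurePreserving E volume volume := by
    refine ⟨E.measurable, ?_⟩
    have h := Real.map_matrix_volume_pi_eq_smul_volume_pi (M := M) (by simp [hM])
    simp only [hM, inv_one, abs_one, ENNReal.ofReal_one, one_smul] at h
    exact h
  refine ⟨E.trans P, (volume_preserving_piFinSuccAbove _ 0).comp hEmp, fun a b => ?_,
    fun X u => ?_⟩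
  · simp only [MeasurableEquiv.trans_apply, hE, Matrix.mulVec_sub]
    rfl
  · ext x
    have hP : P (Fin.cons x u) = (x, u) := by
      simp [P, MeasurableEquiv.piFinSuccAbove, Fin.insertNthEquiv]
    simp only [mem_ofPred_eq, mem_preimage, mem_image, MeasurableEquiv.trans_apply, hE]
    simp_rw [← hP, P.injective.eq_iff]

theorem stmt12 (d n : ℕ) (hn : 1 ≤ n)
    (M : Matrix (Fin (d + 1)) (Fin (d + 1)) ℝ) (hM : M.det = 1)
    (X Y XM YM : Set (Fin (d + 1) → ℝ))
    (hXm : MeasurableSet X) (hYm : MeasurableSet Y)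
    (hXMm : MeasurableSet XM) (hYMm : MeasurableSet YM)
    (hX0 : 0 < volume X) (hX1 : volume X < ⊤)
    (hY0 : 0 < volume Y) (hY1 : volume Y < ⊤)
    (hX : IsSteinerR M X XM) (hY : IsSteinerR M Y YM) :
    expUnionR (fun _ : Fin n => X) (fun _ => Y) ≥
      expUnionR (fun _ : Fin n => XM) (fun _ => YM) := by
  obtain ⟨L, hL, hsub, hsec⟩ := exists_sections_equiv M hM
  have hm : ∀ {S : Set (Fin (d + 1) → ℝ)}, MeasurableSet S → MeasurableSet (L '' S) :=
    fun hS => L.measurableSet_image.2 hS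
  have hvol : ∀ S, (volume.prod volume) (L '' S) = volume S := fun S => by
    rw [← hL.measure_preimage_equiv, preimage_image_eq _ L.injective]
  have hcent : ∀ {S T : Set (Fin (d + 1) → ℝ)}, IsSteinerR M S T → ∀ᵐ v : Fin d → ℝ,
      IsCentredInterval ((fun a => (a, v)) ⁻¹' (L '' T)) ∧
      volume ((fun a => (a, v)) ⁻¹' (L '' T)) = volume ((fun a => (a, v)) ⁻¹' (L '' S)) := by
    intro S T h
    filter_upwards [h] with v hv
    simp only [hsec] at hv
    obtain ⟨c, hc, h1 | h1, h2⟩ := hv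
    · exact ⟨Or.inr ⟨c, hc, h1⟩, h2⟩
    · exact ⟨Or.inl h1, h2⟩
  have heq : ∀ {S T : Set (Fin (d + 1) → ℝ)}, MeasurableSet S → MeasurableSet T →
      IsSteinerR M S T → volume T = volume S := by
    intro S T hS hT h
    rw [← hvol S, ← hvol T, Measure.prod_apply_symm (hm hS), Measure.prod_apply_symm (hm hT)]
    exact lintegral_congr_ae ((hcent h).mono fun _ h => h.2)
  have hXeq := heq hXm hXMm hX
  have hYeq := heq hYm hYMm hY
  have hlin : ∀ S T : Set (Fin (d + 1) → ℝ),
      ∫⁻ z, (volume Y ^ n - (volume Y - setConv volume T S z) ^ n) =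
      ∫⁻ p, (volume Y ^ n - (volume Y - setConv (volume.prod volume) (L '' T) (L '' S) p) ^ n)
        ∂(volume.prod volume) := by
    intro S T
    rw [← hL.lintegral_comp_emb L.measurableEmbedding]
    simp_rw [setConv_image L hL hsub]
  unfold expUnionR
  refine ENNReal.toReal_mono (ENNReal.mul_ne_top ?_
    (setLIntegral_volume_iUnion_ne_top hX1.ne hY1.ne)) ?_
  · exact ENNReal.inv_ne_top.2 (Finset.prod_ne_zero_iff.2 fun _ _ => hY0.ne')
  · dsimp only
    rw [hYeq, setLIntegral_volume_iUnion hXm hYm hY1.ne,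
      setLIntegral_volume_iUnion hXMm hYMm (hYeq ▸ hY1.ne), hYeq, hlin, hlin]
    exact mul_le_mul_right (lintegral_pow_sub_setConv_le (hm hXm) (hm hYm) (hm hXMm) (hm hYMm)
      (hcent hX) (hcent hY) hY1.ne (hvol Y) ((hvol YM).trans hYeq)
      (by rw [hvol, hXeq]; exact hX1.ne) (Nat.one_le_iff_ne_zero.1 hn)) _
end
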